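/- Suppose there exist a C² function W : ℝⁿ → ℝ with W ≥ 1, a point x₀ ∈ ℝⁿ and constants b, c > 0 such that LW(x) ≤ (−c|x − x₀|² + b) W(x) for all x. Then there exists K > 0 such that for every probability density f with respect to μ (f ≥ 0 measurable with ∫ f dμ = 1 and f log f integrable), W₂(f dμ, μ) ≤ √(K · Ent_μ(f)), where Ent_μ(f) = ∫ f log f dμ. -/

import Mathlib

open MeasureTheory Real Set
open scoped ENNReal RealInnerProductSpace

noncomputable section

abbrev En (n : ℕ) := EuclideanSpace ℝ (Fin n)

/-- The Laplacian on `ℝⁿ`: sum of second partial derivatives. -/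
def lapl {n : ℕ} (g : En n → ℝ) (x : En n) : ℝ :=
  ∑ i : Fin n,
    fderiv ℝ (fun y => fderiv ℝ g y (EuclideanSpace.single i 1)) x (EuclideanSpace.single i 1)

/-- The diffusion operator `L g = Δ g - ∇V · ∇g`. -/
def Lop {n : ℕ} (V g : En n → ℝ) (x : En n) : ℝ :=
  lapl g x - ⟪gradient V x, gradient g x⟫

/-- The Boltzmann measure `dμ = e^{-V}/Z dx`. -/
def boltz {n : ℕ} (V : En n → ℝ) : Measure (En n) :=
  (volume : Measure (En n)).withDensity
    (fun x => ENNReal.ofReal (Real.exp (-V x) / ∫ y, Real.exp (-V y)))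

/-- Wasserstein distance of order `p` (as an extended nonnegative real), defined as the infimum
of `(∫ |x-y|^p dcpl)^{1/p}` over all couplings `cpl` of `ν` and `μ`. -/
def Wp {n : ℕ} (p : ℝ) (ν μ : Measure (En n)) : ℝ≥0∞ :=
  ⨅ (cpl : Measure (En n × En n)) (_ : IsProbabilityMeasure cpl)
    (_ : cpl.map Prod.fst = ν) (_ : cpl.map Prod.snd = μ),
    (∫⁻ q, (‖q.1 - q.2‖₊ : ℝ≥0∞) ^ p ∂cpl) ^ (1 / p)

/-- Finite-dimensional Kantorovich duality: if every dual feasible pair has value at most `T`,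
there is a transport plan of cost at most `T`. -/
theorem exists_transport_plan_of_dual_le {ι : Type*} [Fintype ι] (c : ι → ι → ℝ) (p q : ι → ℝ)
    (hp : ∀ i, 0 ≤ p i) (hq : ∀ i, 0 ≤ q i) (hp1 : ∑ i, p i = 1) (hq1 : ∑ i, q i = 1) (T : ℝ)
    (H : ∀ a b : ι → ℝ, (∀ i j, a i + b j ≤ c i j) →
      ∑ i, a i * p i + ∑ j, b j * q j ≤ T) :
    ∃ w : ι → ι → ℝ, (∀ i j, 0 ≤ w i j) ∧ (∀ i, ∑ j, w i j = p i) ∧ (∀ j, ∑ i, w i j = q j) ∧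
      ∑ i, ∑ j, w i j * c i j ≤ T := by
  classical
  let Φ : (ι × ι → ℝ) → (ι → ℝ) × (ι → ℝ) × ℝ := fun w =>
    (fun i => ∑ j, w (i, j), fun j => ∑ i, w (i, j), ∑ i, ∑ j, w (i, j) * c i j)
  have hΦlin : IsLinearMap ℝ Φ := by
    constructor
    · intro x y
      simp only [Φ, Prod.mk_add_mk, Prod.mk.injEq]
      refine ⟨?_, ?_, ?_⟩
      · ext i; simp [Finset.sum_add_distrib]
      · ext i; simp [Finset.sum_add_distrib]
      · simp [Finset.sum_add_distrib, add_mul]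
    · intro r x
      simp only [Φ, Prod.smul_mk, Prod.mk.injEq]
      refine ⟨?_, ?_, ?_⟩
      · ext i; simp [Finset.mul_sum]
      · ext i; simp [Finset.mul_sum]
      · simp [Finset.mul_sum, mul_assoc]
  have hΦcont : Continuous Φ := by
    simp only [Φ]
    fun_prop
  by_contra hcon
  push Not at hcon
  have hdisj : Disjoint (Φ '' stdSimplex ℝ (ι × ι)) (({p} : Set (ι → ℝ)) ×ˢ ({q} ×ˢ Iic T)) := by
    rw [Set.disjoint_left]
    rintro _ ⟨w, hw, rfl⟩ ⟨h1, h2, h3⟩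
    simp only [Φ, mem_singleton_iff, mem_Iic] at h1 h2 h3
    exact absurd h3 (not_le.2 (hcon (fun i j => w (i, j)) (fun i j => hw.1 _)
      (fun i => congrFun h1 i) (fun j => congrFun h2 j)))
  obtain ⟨f, u, v, hfu, huv, hfv⟩ := geometric_hahn_banach_compact_closed
    ((convex_stdSimplex ℝ (ι × ι)).is_linear_image hΦlin)
    ((isCompact_stdSimplex ℝ (ι × ι)).image hΦcont)
    ((convex_singleton p).prod ((convex_singleton q).prod (convex_Iic T)))
    (isClosed_singleton.prod (isClosed_singleton.prod isClosed_Iic)) hdisj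
  set α : ι → ℝ := fun i => f (Pi.single i 1, 0, 0)
  set β : ι → ℝ := fun i => f (0, Pi.single i 1, 0)
  set γ : ℝ := f (0, 0, 1)
  have hf : ∀ x y s, f (x, y, s) = ∑ i, α i * x i + ∑ j, β j * y j + γ * s := by
    intro x y s
    have e1 : (x, y, s) = ∑ i, x i • ((Pi.single i 1, 0, 0) : (ι → ℝ) × (ι → ℝ) × ℝ)
        + ∑ i, y i • ((0, Pi.single i 1, 0) : (ι → ℝ) × (ι → ℝ) × ℝ) + s • (0, 0, 1) := by
      have hs : ∀ z : ι → ℝ, ∑ i, z i • (Pi.single i 1 : ι → ℝ) = z := by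
        intro z; ext k; simp [Finset.sum_apply, Pi.single_apply]
      simp only [Prod.smul_mk, smul_zero, smul_eq_mul, mul_one]
      ext1
      · simp [Prod.fst_sum, hs]
      · ext1 <;> simp [Prod.fst_sum, Prod.snd_sum, hs]
    rw [e1]
    simp only [map_add, map_sum, map_smul, smul_eq_mul, α, β, γ]
    simp [mul_comm]
  have hdelta : ∀ i j, α i + β j + γ * c i j < u := by
    intro i j
    have h := hfu _ ⟨Pi.single (i, j) 1, single_mem_stdSimplex ℝ (i, j), rfl⟩
    have e : Φ (Pi.single (i, j) 1) = (Pi.single i 1, Pi.single j 1, c i j) := by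
      simp only [Φ, Prod.mk.injEq]
      refine ⟨?_, ?_, ?_⟩
      · ext k; by_cases hk : k = i <;> simp [Pi.single_apply, hk]
      · ext k; by_cases hk : k = j <;> simp [Pi.single_apply, hk]
      · rw [Finset.sum_eq_single i, Finset.sum_eq_single j] <;>
          simp +contextual [Pi.single_apply]
    rw [e, hf] at h
    simpa [Pi.single_apply] using h
  have hpt : ∀ s ≤ T, v < ∑ i, α i * p i + ∑ j, β j * q j + γ * s := by
    intro s hs
    rw [← hf]
    exact hfv _ ⟨rfl, rfl, hs⟩
  have hγ0 : γ ≤ 0 := by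
    by_contra h
    push Not at h
    set A := ∑ i, α i * p i + ∑ j, β j * q j
    have := hpt (min T ((v - A) / γ)) (min_le_left _ _)
    have h2 : γ * min T ((v - A) / γ) ≤ γ * ((v - A) / γ) :=
      mul_le_mul_of_nonneg_left (min_le_right _ _) h.le
    rw [mul_div_cancel₀ _ h.ne'] at h2
    linarith
  have hT := hpt T le_rfl
  have avg : ∀ a b : ι → ℝ, ∑ i, a i * p i + ∑ j, b j * q j =
      ∑ i, ∑ j, (a i + b j) * (p i * q j) := by
    intro a b
    have : ∀ i j, (a i + b j) * (p i * q j) = a i * p i * q j + p i * (b j * q j) := by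
      intros; ring
    simp only [this, Finset.sum_add_distrib, ← Finset.mul_sum, hq1, mul_one]
    rw [← Finset.sum_mul, hp1, one_mul]
  rcases hγ0.lt_or_eq with hγ | hγ
  · have := H (fun i => (α i - u) / (-γ)) (fun j => β j / (-γ)) (by
      intro i j
      rw [← add_div, div_le_iff₀ (by linarith)]
      linarith [hdelta i j])
    have e : ∑ i, (α i - u) / (-γ) * p i + ∑ j, β j / (-γ) * q j =
        (∑ i, α i * p i + ∑ j, β j * q j - u) / (-γ) := by
      have e1 : ∀ i, (α i - u) / (-γ) * p i = (α i * p i - u * p i) / (-γ) := by intro i; ring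
      have e2 : ∀ i, β i / (-γ) * q i = (β i * q i) / (-γ) := by intro i; ring
      simp only [e1, e2, ← Finset.sum_div, Finset.sum_sub_distrib, ← Finset.mul_sum, hp1]
      ring
    rw [e, div_le_iff₀ (by linarith)] at this
    linarith
  · rw [hγ] at hT
    rw [avg] at hT
    have : ∑ i, ∑ j, (α i + β j) * (p i * q j) ≤ ∑ i, ∑ j, u * (p i * q j) := by
      refine Finset.sum_le_sum fun i _ => Finset.sum_le_sum fun j _ => ?_
      refine mul_le_mul_of_nonneg_right ?_ (mul_nonneg (hp i) (hq j))
      have := hdelta i j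
      rw [hγ] at this
      linarith
    simp only [← Finset.mul_sum, hq1, mul_one, hp1] at this
    linarith

theorem ae_measure_fiber_ne_zero {X ι : Type*} [MeasurableSpace X] [Fintype ι]
    (ν : Measure X) (κ : X → ι) :
    ∀ᵐ x ∂ν, ν (κ ⁻¹' {κ x}) ≠ 0 := by
  have : {x | ¬ ν (κ ⁻¹' {κ x}) ≠ 0} ⊆ ⋃ i ∈ {i | ν (κ ⁻¹' {i}) = 0}, κ ⁻¹' {i} := by
    intro x hx
    simp only [ne_eq, not_not, mem_ofPred_eq] at hx
    simp only [mem_ofPred_eq, mem_iUnion]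
    exact ⟨κ x, hx, rfl⟩
  refine measure_mono_null this ?_
  rw [measure_biUnion_null_iff (Set.to_countable _)]
  exact fun i hi => hi

section Coupling

variable {X ι : Type*} [MeasurableSpace X] [Fintype ι] [MeasurableSpace ι]
  [MeasurableSingletonClass ι]

theorem lintegral_comp_fintype (ν : Measure X) {κ : X → ι} (hκ : Measurable κ)
    (F : ι → ℝ≥0∞) : ∫⁻ x, F (κ x) ∂ν = ∑ i, F i * ν (κ ⁻¹' {i}) := by
  rw [← lintegral_map (measurable_of_countable F) hκ, lintegral_fintype]
  refine Finset.sum_congr rfl fun i _ => ?_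
  rw [Measure.map_apply hκ (measurableSet_singleton i)]

theorem integral_comp_fintype (ν : Measure X) [IsFiniteMeasure ν] {κ : X → ι}
    (hκ : Measurable κ) (F : ι → ℝ) :
    ∫ x, F (κ x) ∂ν = ∑ i, F i * ν.real (κ ⁻¹' {i}) := by
  rw [← integral_map hκ.aemeasurable (measurable_of_countable F).aestronglyMeasurable,
    integral_fintype Integrable.of_finite]
  refine Finset.sum_congr rfl fun i _ => ?_
  rw [map_measureReal_apply hκ (measurableSet_singleton i), smul_eq_mul, mul_comm]

/-- A transport plan between the cell masses of a finite measurable partition lifts to a coupling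
of the measures themselves. -/
theorem exists_coupling_of_cell_dual_le (ν μ : Measure X) [IsProbabilityMeasure ν]
    [IsProbabilityMeasure μ] {κ : X → ι} (hκ : Measurable κ) (c : ι → ι → ℝ)
    (hc : ∀ i j, 0 ≤ c i j) (T : ℝ)
    (H : ∀ a b : ι → ℝ, (∀ i j, a i + b j ≤ c i j) →
      ∫ x, a (κ x) ∂ν + ∫ x, b (κ x) ∂μ ≤ T) :
    ∃ cpl : Measure (X × X), IsProbabilityMeasure cpl ∧ cpl.map Prod.fst = ν ∧
      cpl.map Prod.snd = μ ∧
      ∫⁻ z, ENNReal.ofReal (c (κ z.1) (κ z.2)) ∂cpl ≤ ENNReal.ofReal T := by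
  classical
  have hsum : ∀ ρ : Measure X, IsProbabilityMeasure ρ → ∑ i, ρ.real (κ ⁻¹' {i}) = 1 := by
    intro ρ _
    have := integral_comp_fintype ρ hκ (fun _ => (1 : ℝ))
    simpa using this.symm
  obtain ⟨w, hw0, hwp, hwq, hwT⟩ := exists_transport_plan_of_dual_le c
    (fun i => ν.real (κ ⁻¹' {i})) (fun i => μ.real (κ ⁻¹' {i})) (fun _ => measureReal_nonneg)
    (fun _ => measureReal_nonneg) (hsum ν inferInstance) (hsum μ inferInstance) T (by
      intro a b hab
      have := H a b hab
      rwa [integral_comp_fintype ν hκ, integral_comp_fintype μ hκ] at this)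
  set D : ι → ι → ℝ≥0∞ := fun i j =>
    ENNReal.ofReal (w i j) * (ν (κ ⁻¹' {i}))⁻¹ * (μ (κ ⁻¹' {j}))⁻¹ with hD
  have hwν : ∀ i j, ν (κ ⁻¹' {i}) = 0 → w i j = 0 := by
    intro i j h
    have := hwp i
    rw [measureReal_def, h, ENNReal.toReal_zero,
      Finset.sum_eq_zero_iff_of_nonneg (fun j _ => hw0 i j)] at this
    exact this j (Finset.mem_univ _)
  have hwμ : ∀ i j, μ (κ ⁻¹' {j}) = 0 → w i j = 0 := by
    intro i j h
    have := hwq j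
    rw [measureReal_def, h, ENNReal.toReal_zero,
      Finset.sum_eq_zero_iff_of_nonneg (fun i _ => hw0 i j)] at this
    exact this i (Finset.mem_univ _)
  have hDμ : ∀ i j, D i j * μ (κ ⁻¹' {j}) = ENNReal.ofReal (w i j) * (ν (κ ⁻¹' {i}))⁻¹ := by
    intro i j
    by_cases h : μ (κ ⁻¹' {j}) = 0
    · simp [hD, hwμ i j h]
    · rw [hD]
      simp only
      rw [mul_assoc, ENNReal.inv_mul_cancel h (measure_ne_top _ _), mul_one]
  have hDν : ∀ i j, D i j * ν (κ ⁻¹' {i}) = ENNReal.ofReal (w i j) * (μ (κ ⁻¹' {j}))⁻¹ := by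
    intro i j
    by_cases h : ν (κ ⁻¹' {i}) = 0
    · simp [hD, hwν i j h]
    · rw [hD]
      simp only
      rw [mul_assoc, mul_assoc, mul_comm (μ (κ ⁻¹' {j}))⁻¹, ← mul_assoc (ν (κ ⁻¹' {i}))⁻¹,
        ENNReal.inv_mul_cancel h (measure_ne_top _ _), one_mul]
  have hDν' : ∀ i j, D i j * μ (κ ⁻¹' {j}) * ν (κ ⁻¹' {i}) = ENNReal.ofReal (w i j) := by
    intro i j
    rw [hDμ]
    by_cases h : ν (κ ⁻¹' {i}) = 0
    · simp [hwν i j h]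
    · rw [mul_assoc, ENNReal.inv_mul_cancel h (measure_ne_top _ _), mul_one]
  have hDmeas : Measurable fun z : X × X => D (κ z.1) (κ z.2) :=
    (measurable_of_countable (fun z : ι × ι => D z.1 z.2)).comp
      ((hκ.comp measurable_fst).prodMk (hκ.comp measurable_snd))
  set cpl : Measure (X × X) := (ν.prod μ).withDensity fun z => D (κ z.1) (κ z.2) with hcpl
  have hfst : cpl.map Prod.fst = ν := by
    ext s hs
    rw [Measure.map_apply measurable_fst hs, hcpl, withDensity_apply _ (measurable_fst hs),
      ← lintegral_indicator (measurable_fst hs),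
      lintegral_prod _ (hDmeas.indicator (measurable_fst hs)).aemeasurable,
      ← lintegral_indicator_one hs]
    refine lintegral_congr_ae ?_
    filter_upwards [ae_measure_fiber_ne_zero ν κ] with x hx
    by_cases hxs : x ∈ s
    · have e : ∀ y, (Prod.fst ⁻¹' s).indicator (fun z : X × X => D (κ z.1) (κ z.2)) (x, y)
          = D (κ x) (κ y) := fun y => indicator_of_mem (s := Prod.fst ⁻¹' s) hxs _
      simp only [e]
      rw [lintegral_comp_fintype μ hκ (fun j => D (κ x) j)]
      simp only [hDμ, hxs, indicator_of_mem, Pi.one_apply]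
      rw [← Finset.sum_mul, ← ENNReal.ofReal_sum_of_nonneg (fun j _ => hw0 _ j), hwp,
        ofReal_measureReal, ENNReal.mul_inv_cancel hx (measure_ne_top _ _)]
    · simp [hxs]
  have hsnd : cpl.map Prod.snd = μ := by
    ext s hs
    rw [Measure.map_apply measurable_snd hs, hcpl, withDensity_apply _ (measurable_snd hs),
      ← lintegral_indicator (measurable_snd hs),
      lintegral_prod_symm _ (hDmeas.indicator (measurable_snd hs)).aemeasurable,
      ← lintegral_indicator_one hs]
    refine lintegral_congr_ae ?_
    filter_upwards [ae_measure_fiber_ne_zero μ κ] with y hy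
    by_cases hys : y ∈ s
    · have e : ∀ x, (Prod.snd ⁻¹' s).indicator (fun z : X × X => D (κ z.1) (κ z.2)) (x, y)
          = D (κ x) (κ y) := fun x => indicator_of_mem (s := Prod.snd ⁻¹' s) hys _
      simp only [e]
      rw [lintegral_comp_fintype ν hκ (fun i => D i (κ y))]
      simp only [hDν, hys, indicator_of_mem, Pi.one_apply]
      rw [← Finset.sum_mul, ← ENNReal.ofReal_sum_of_nonneg (fun i _ => hw0 i _), hwq,
        ofReal_measureReal, ENNReal.mul_inv_cancel hy (measure_ne_top _ _)]
    · simp [hys]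
  have hprob : IsProbabilityMeasure cpl := by
    have : IsProbabilityMeasure (cpl.map Prod.fst) := by rw [hfst]; infer_instance
    exact Measure.isProbabilityMeasure_of_map (μ := cpl) Prod.fst
  refine ⟨cpl, hprob, hfst, hsnd, ?_⟩
  have hcm : Measurable fun z : X × X => ENNReal.ofReal (c (κ z.1) (κ z.2)) :=
    (measurable_of_countable (fun z : ι × ι => ENNReal.ofReal (c z.1 z.2))).comp
      ((hκ.comp measurable_fst).prodMk (hκ.comp measurable_snd))
  rw [hcpl, lintegral_withDensity_eq_lintegral_mul _ hDmeas hcm,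
    lintegral_prod _ (hDmeas.mul hcm).aemeasurable]
  simp only [Pi.mul_apply]
  have e : ∀ x, ∫⁻ y, D (κ x) (κ y) * ENNReal.ofReal (c (κ x) (κ y)) ∂μ =
      ∑ j, D (κ x) j * ENNReal.ofReal (c (κ x) j) * μ (κ ⁻¹' {j}) := fun x =>
    lintegral_comp_fintype μ hκ (fun j => D (κ x) j * ENNReal.ofReal (c (κ x) j))
  simp only [e]
  rw [lintegral_comp_fintype ν hκ
    (fun i => ∑ j, D i j * ENNReal.ofReal (c i j) * μ (κ ⁻¹' {j}))]
  refine le_trans (le_of_eq ?_) (ENNReal.ofReal_le_ofReal hwT)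
  rw [ENNReal.ofReal_sum_of_nonneg
    (fun i _ => Finset.sum_nonneg fun j _ => mul_nonneg (hw0 i j) (hc i j))]
  refine Finset.sum_congr rfl fun i _ => ?_
  rw [ENNReal.ofReal_sum_of_nonneg (fun j _ => mul_nonneg (hw0 i j) (hc i j)), Finset.sum_mul]
  refine Finset.sum_congr rfl fun j _ => ?_
  rw [ENNReal.ofReal_mul (hw0 i j), ← hDν' i j]
  ring

end Coupling

/-- The Hopf-Lax (quadratic infimum-convolution) semigroup. -/
def hopfLax {n : ℕ} (h : En n → ℝ) (t : ℝ) (x : En n) : ℝ := ⨅ y, h y + ‖x - y‖ ^ 2 / (2 * t)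

section HopfLax

variable {n : ℕ} {h : En n → ℝ} {M s t : ℝ}

theorem hopfLax_le (hM : ∀ x, |h x| ≤ M) (ht : 0 < t) (x y : En n) :
    hopfLax h t x ≤ h y + ‖x - y‖ ^ 2 / (2 * t) := by
  refine ciInf_le ⟨-M, ?_⟩ y
  rintro _ ⟨z, rfl⟩
  have := (abs_le.1 (hM z)).1
  have : 0 ≤ ‖x - z‖ ^ 2 / (2 * t) := by positivity
  simp only
  linarith

theorem le_hopfLax {a : ℝ} {x : En n} (H : ∀ y, a ≤ h y + ‖x - y‖ ^ 2 / (2 * t)) :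
    a ≤ hopfLax h t x := le_ciInf H

theorem hopfLax_le_self (hM : ∀ x, |h x| ≤ M) (ht : 0 < t) (x : En n) :
    hopfLax h t x ≤ h x := by
  simpa using hopfLax_le hM ht x x

theorem abs_hopfLax_le (hM : ∀ x, |h x| ≤ M) (ht : 0 < t) (x : En n) :
    |hopfLax h t x| ≤ M := by
  refine abs_le.2 ⟨le_hopfLax fun y => ?_,
    (hopfLax_le_self hM ht x).trans (abs_le.1 (hM x)).2⟩
  have := (abs_le.1 (hM y)).1
  have : 0 ≤ ‖x - y‖ ^ 2 / (2 * t) := by positivity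
  linarith

theorem exists_lipschitzWith_hopfLax (hM : ∀ x, |h x| ≤ M) (ht : 0 < t) :
    ∃ L, LipschitzWith L (hopfLax h t) := by
  have hM0 : 0 ≤ M := (abs_nonneg _).trans (hM 0)
  set r := √(4 * M * t) with hr
  set L := 2 * M + (1 + 2 * r) / (2 * t) with hL
  have hL0 : 0 ≤ L := by positivity
  refine ⟨L.toNNReal, LipschitzWith.of_le_add_mul _ fun x x' => ?_⟩
  rw [Real.coe_toNNReal _ hL0, dist_eq_norm, ← sub_le_iff_le_add]
  refine le_hopfLax fun y => ?_
  rw [sub_le_iff_le_add]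
  have hQ := (abs_le.1 (abs_hopfLax_le hM ht x)).2
  have hy := (abs_le.1 (hM y)).1
  rcases le_total (2 * M) (‖x' - y‖ ^ 2 / (2 * t)) with h1 | h1
  · have : 0 ≤ L * ‖x - x'‖ := by positivity
    linarith
  rcases le_total 1 ‖x - x'‖ with h2 | h2
  · have h3 : 2 * M ≤ L * ‖x - x'‖ := by
      have : 2 * M ≤ L := by
        rw [hL]; have : 0 ≤ (1 + 2 * r) / (2 * t) := by positivity
        linarith
      nlinarith
    have : 0 ≤ ‖x' - y‖ ^ 2 / (2 * t) := by positivity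
    linarith
  · have hx'y : ‖x' - y‖ ≤ r := by
      rw [hr]
      refine Real.le_sqrt_of_sq_le ?_
      rw [div_le_iff₀ (by positivity)] at h1
      linarith
    have htri : ‖x - y‖ ≤ ‖x - x'‖ + ‖x' - y‖ := norm_sub_le_norm_sub_add_norm_sub _ _ _
    have h4 : ‖x - y‖ ^ 2 ≤ ‖x' - y‖ ^ 2 + ‖x - x'‖ * (1 + 2 * r) := by
      have := norm_nonneg (x - y)
      have := norm_nonneg (x - x')
      have := norm_nonneg (x' - y)
      nlinarith
    have h5 := hopfLax_le hM ht x y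
    have h6 : ‖x - y‖ ^ 2 / (2 * t) ≤
        ‖x' - y‖ ^ 2 / (2 * t) + (1 + 2 * r) / (2 * t) * ‖x - x'‖ := by
      rw [div_mul_eq_mul_div, ← add_div]
      gcongr
      linarith
    have h7 : 0 ≤ 2 * M * ‖x - x'‖ := by positivity
    rw [hL, add_mul]
    linarith

theorem hopfLax_add_le (hM : ∀ x, |h x| ≤ M) (ht : 0 < t) (hs : 0 < s) (x z : En n) :
    hopfLax h (t + s) x ≤ hopfLax h t z + ‖x - z‖ ^ 2 / (2 * s) := by
  rw [← sub_le_iff_le_add]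
  refine le_hopfLax fun y => ?_
  rw [sub_le_iff_le_add]
  refine (hopfLax_le hM (by positivity) x y).trans ?_
  have htri : ‖x - y‖ ≤ ‖x - z‖ + ‖z - y‖ := norm_sub_le_norm_sub_add_norm_sub _ _ _
  have : ‖x - y‖ ^ 2 / (2 * (t + s)) ≤ ‖z - y‖ ^ 2 / (2 * t) + ‖x - z‖ ^ 2 / (2 * s) := by
    have h1 : ‖x - y‖ ^ 2 ≤ (‖x - z‖ + ‖z - y‖) ^ 2 := by gcongr
    rw [div_add_div _ _ (by positivity) (by positivity), div_le_div_iff₀ (by positivity)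
      (by positivity)]
    have h2 : 0 ≤ (‖x - z‖ * t - ‖z - y‖ * s) ^ 2 := sq_nonneg _
    have h3 : ‖x - y‖ ^ 2 * (t * s) ≤ (‖x - z‖ + ‖z - y‖) ^ 2 * (t * s) := by gcongr
    nlinarith
  linarith

theorem hopfLax_anti (hM : ∀ x, |h x| ≤ M) (hs : 0 < s) (hst : s ≤ t) (x : En n) :
    hopfLax h t x ≤ hopfLax h s x := by
  refine le_hopfLax fun y => (hopfLax_le hM (hs.trans_le hst) x y).trans ?_
  gcongr

theorem hopfLax_le_add (hM : ∀ x, |h x| ≤ M) (hs : 0 < s) (hst : s ≤ t) (x : En n) :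
    hopfLax h s x ≤ hopfLax h t x + 2 * M * (t / s - 1) := by
  have hM0 : 0 ≤ M := (abs_nonneg _).trans (hM 0)
  have ht := hs.trans_le hst
  have hr : 0 ≤ t / s - 1 := by rw [sub_nonneg, one_le_div hs]; exact hst
  rw [← sub_le_iff_le_add]
  refine le_hopfLax fun y => ?_
  rw [sub_le_iff_le_add]
  have hQ := (abs_le.1 (abs_hopfLax_le hM hs x)).2
  have hy := (abs_le.1 (hM y)).1
  rcases le_total (2 * M) (‖x - y‖ ^ 2 / (2 * t)) with h1 | h1
  · have : 0 ≤ 2 * M * (t / s - 1) := by positivity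
    linarith
  · have h2 := hopfLax_le hM hs x y
    have h3 : ‖x - y‖ ^ 2 / (2 * s) = ‖x - y‖ ^ 2 / (2 * t)
        + ‖x - y‖ ^ 2 / (2 * t) * (t / s - 1) := by
      field_simp
      ring
    have := mul_le_mul_of_nonneg_right h1 hr
    linarith

end HopfLax

theorem exists_finite_partition {n : ℕ} (x₀ : En n) (R : ℝ) {δ : ℝ} (hδ : 0 < δ) :
    ∃ (N : ℕ) (κ : En n → Fin (N + 1)) (e : Fin (N + 1) → En n), Measurable κ ∧
      (∀ x, ‖x - x₀‖ ≤ R → κ x ≠ 0 ∧ ‖e (κ x) - x‖ ≤ δ) ∧ ∀ x, R < ‖x - x₀‖ → κ x = 0 := by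
  classical
  set d := TopologicalSpace.denseSeq (En n)
  obtain ⟨t, ht⟩ := (isCompact_closedBall x₀ R).elim_finite_subcover
    (fun k : ℕ => Metric.ball (d k) δ) (fun _ => Metric.isOpen_ball) (by
      intro x _
      obtain ⟨k, hk⟩ := (TopologicalSpace.denseRange_denseSeq (En n)).exists_mem_open
        Metric.isOpen_ball ⟨x, Metric.mem_ball_self hδ⟩
      exact mem_iUnion.2 ⟨k, Metric.mem_ball'.2 hk⟩)
  set N := t.sup id
  refine ⟨N + 1, fun x => if ‖x - x₀‖ ≤ R then
      Fin.ofNat (N + 2) (SimpleFunc.nearestPtInd d N x + 1) else 0,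
    fun i => d (i - 1), ?_, ?_, ?_⟩
  · refine Measurable.ite (measurableSet_le (by fun_prop) measurable_const) ?_ measurable_const
    exact (measurable_of_countable fun k : ℕ => Fin.ofNat (N + 2) (k + 1)).comp
      (SimpleFunc.measurable _)
  · intro x hx
    simp only [hx, if_true]
    have hval : (Fin.ofNat (N + 2) (SimpleFunc.nearestPtInd d N x + 1) : ℕ)
        = SimpleFunc.nearestPtInd d N x + 1 :=
      Nat.mod_eq_of_lt (by have := SimpleFunc.nearestPtInd_le d N x; omega)
    refine ⟨fun h => by rw [h] at hval; simp at hval, ?_⟩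
    rw [hval]
    have : x ∈ Metric.closedBall x₀ R := by rwa [mem_closedBall_iff_norm]
    obtain ⟨k, hk, hxk⟩ := mem_iUnion₂.1 (ht this)
    have hkN : k ≤ N := Finset.le_sup (f := id) hk
    have h1 := SimpleFunc.edist_nearestPt_le d x hkN
    rw [edist_dist, edist_dist, ENNReal.ofReal_le_ofReal_iff dist_nonneg] at h1
    rw [Metric.mem_ball, dist_comm] at hxk
    have h2 : ‖d (SimpleFunc.nearestPtInd d N x) - x‖ ≤ dist (d k) x := by
      rw [← dist_eq_norm]; exact h1
    simpa using h2.trans hxk.le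
  · intro x hx
    simp [not_le.2 hx]

/-- If the dual functional `∫ Q₁h dν - ∫ h dμ` is bounded by `S`, then `W₂(ν, μ)² ≤ 4 S`. -/
theorem Wp_two_le_of_hopfLax_le {n : ℕ} (x₀ : En n) (ν μ : Measure (En n))
    [IsProbabilityMeasure ν] [IsProbabilityMeasure μ]
    (hν : ∫⁻ x, ENNReal.ofReal (‖x - x₀‖ ^ 2) ∂ν ≠ ∞)
    (hμ : ∫⁻ x, ENNReal.ofReal (‖x - x₀‖ ^ 2) ∂μ ≠ ∞) {S : ℝ} (hS : 0 ≤ S)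
    (H : ∀ h : En n → ℝ, Measurable h → (∃ M, ∀ x, |h x| ≤ M) →
      ∫ x, hopfLax h 1 x ∂ν ≤ ∫ x, h x ∂μ + S) :
    Wp 2 ν μ ≤ ENNReal.ofReal (√(4 * S)) := by
  have key : ∀ (R δ : ℝ), 0 < δ → Wp 2 ν μ ^ (2 : ℝ) ≤ ENNReal.ofReal (4 * S + 32 * δ ^ 2) +
      (∫⁻ x, {x | R < ‖x - x₀‖}.indicator (fun x => 4 * ENNReal.ofReal (‖x - x₀‖ ^ 2)) x ∂ν +
      ∫⁻ x, {x | R < ‖x - x₀‖}.indicator (fun x => 4 * ENNReal.ofReal (‖x - x₀‖ ^ 2)) x ∂μ) := by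
    intro R δ hδ
    obtain ⟨N, κ, e, hκ, hin, hout⟩ := exists_finite_partition x₀ R hδ
    have hin' : ∀ x, κ x ≠ 0 → ‖e (κ x) - x‖ ≤ δ := fun x hx =>
      (hin x (not_lt.1 fun h => hx (hout x h))).2
    set c : Fin (N + 1) → Fin (N + 1) → ℝ := fun i j =>
      if i = 0 ∨ j = 0 then 0 else (‖e i - e j‖ + 2 * δ) ^ 2 with hc
    have hc0 : ∀ i j, 0 ≤ c i j := by
      intro i j
      simp only [hc]
      split_ifs <;> positivity
    have hcle : ∀ x y, c (κ x) (κ y) ≤ (‖x - y‖ + 4 * δ) ^ 2 := by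
      intro x y
      simp only [hc]
      split_ifs with h
      · positivity
      · push Not at h
        have h1 := hin' x h.1
        have h2 := hin' y h.2
        have : e (κ x) - e (κ y) = (e (κ x) - x) + (x - y) - (e (κ y) - y) := by abel
        have h3 : ‖e (κ x) - e (κ y)‖ ≤ ‖x - y‖ + 2 * δ := by
          rw [this]
          refine (norm_sub_le _ _).trans ?_
          have := norm_add_le (e (κ x) - x) (x - y)
          linarith
        refine pow_le_pow_left₀ (by positivity) (by linarith) 2
    obtain ⟨cpl, hprob, hfst, hsnd, hcost⟩ := exists_coupling_of_cell_dual_le ν μ hκ c hc0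
        (4 * S + 32 * δ ^ 2) (by
      intro a b hab
      have hfin : ∀ u : Fin (N + 1) → ℝ, ∃ M, ∀ x, |u (κ x)| ≤ M := by
        intro u
        obtain ⟨M, hM⟩ := (Set.finite_range fun i => |u i|).bddAbove
        exact ⟨M, fun x => hM ⟨κ x, rfl⟩⟩
      have hmeas : ∀ u : Fin (N + 1) → ℝ, Measurable fun x => u (κ x) := fun u =>
        (measurable_of_countable u).comp hκ
      have hInt : ∀ (u : Fin (N + 1) → ℝ) (ρ : Measure (En n)), IsProbabilityMeasure ρ →
          Integrable (fun x => u (κ x)) ρ := by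
        intro u ρ _
        obtain ⟨M, hM⟩ := hfin u
        exact Integrable.of_bound (hmeas u).aestronglyMeasurable M (ae_of_all _ hM)
      obtain ⟨M, hM⟩ := hfin (fun i => -(b i) / 4)
      have hH := H (fun y => -(b (κ y)) / 4) (hmeas fun i => -(b i) / 4) ⟨M, hM⟩
      obtain ⟨L, hL⟩ := exists_lipschitzWith_hopfLax hM one_pos
      have hQint : Integrable (hopfLax (fun y => -(b (κ y)) / 4) 1) ν :=
        Integrable.of_bound hL.continuous.aestronglyMeasurable M
          (ae_of_all _ (abs_hopfLax_le hM one_pos))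
      have hle : ∀ x, a (κ x) ≤ 4 * hopfLax (fun y => -(b (κ y)) / 4) 1 x + 32 * δ ^ 2 := by
        intro x
        have : (a (κ x) - 32 * δ ^ 2) / 4 ≤ hopfLax (fun y => -(b (κ y)) / 4) 1 x := by
          refine le_hopfLax fun y => ?_
          have h1 := (hab (κ x) (κ y)).trans (hcle x y)
          nlinarith [sq_nonneg (‖x - y‖ - 4 * δ)]
        linarith
      have h2 : ∫ x, a (κ x) ∂ν ≤
          ∫ x, (4 * hopfLax (fun y => -(b (κ y)) / 4) 1 x + 32 * δ ^ 2) ∂ν :=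
        integral_mono (hInt a ν inferInstance) ((hQint.const_mul 4).add (integrable_const _)) hle
      rw [integral_add (hQint.const_mul 4) (integrable_const _), integral_const_mul] at h2
      simp only [integral_const, probReal_univ, one_smul] at h2
      have h3 : ∫ y, -(b (κ y)) / 4 ∂μ = -(∫ y, b (κ y) ∂μ) / 4 := by
        rw [integral_div, integral_neg]
      rw [h3] at hH
      linarith)
    have hW : Wp 2 ν μ ≤ (∫⁻ q, (‖q.1 - q.2‖₊ : ℝ≥0∞) ^ (2 : ℝ) ∂cpl) ^ ((1 : ℝ) / 2) :=
      iInf_le_of_le cpl (iInf_le_of_le hprob (iInf_le_of_le hfst (iInf_le_of_le hsnd le_rfl)))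
    have hW2 : Wp 2 ν μ ^ (2 : ℝ) ≤ ∫⁻ q, (‖q.1 - q.2‖₊ : ℝ≥0∞) ^ (2 : ℝ) ∂cpl := by
      refine (ENNReal.rpow_le_rpow hW (by norm_num)).trans ?_
      rw [← ENNReal.rpow_mul]
      norm_num
    refine hW2.trans ?_
    set g : En n → ℝ≥0∞ :=
      {x | R < ‖x - x₀‖}.indicator (fun x => 4 * ENNReal.ofReal (‖x - x₀‖ ^ 2)) with hg
    have hgm : Measurable g := by
      refine Measurable.indicator (by fun_prop) ?_
      exact measurableSet_lt measurable_const (by fun_prop)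
    have hpt : ∀ q : En n × En n, (‖q.1 - q.2‖₊ : ℝ≥0∞) ^ (2 : ℝ) ≤
        ENNReal.ofReal (c (κ q.1) (κ q.2)) + (g q.1 + g q.2) := by
      rintro ⟨x, y⟩
      have e0 : (‖x - y‖₊ : ℝ≥0∞) ^ (2 : ℝ) = ENNReal.ofReal (‖x - y‖ ^ 2) := by
        rw [ENNReal.ofReal_pow (norm_nonneg _), ofReal_norm]
        norm_cast
      have hgR : ∀ z, R < ‖z - x₀‖ → g z = ENNReal.ofReal (4 * ‖z - x₀‖ ^ 2) := by
        intro z hz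
        rw [hg, indicator_of_mem (by exact hz), ENNReal.ofReal_mul (by norm_num)]
        norm_num
      simp only
      rw [e0]
      have htri : ‖x - y‖ ≤ ‖x - x₀‖ + ‖y - x₀‖ := by
        rw [← norm_sub_rev x₀ y]; exact norm_sub_le_norm_sub_add_norm_sub _ _ _
      have hn0 := norm_nonneg (x - y)
      have hn1 := norm_nonneg (x - x₀)
      have hn2 := norm_nonneg (y - x₀)
      rcases le_or_gt ‖x - x₀‖ R with hx | hx <;> rcases le_or_gt ‖y - x₀‖ R with hy | hy
      · refine le_add_right (ENNReal.ofReal_le_ofReal ?_)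
        obtain ⟨hx0, hx1⟩ := hin x hx
        obtain ⟨hy0, hy1⟩ := hin y hy
        simp only [hc, hx0, hy0, or_self, if_false]
        refine pow_le_pow_left₀ hn0 ?_ 2
        have : x - y = (e (κ x) - e (κ y)) - (e (κ x) - x) + (e (κ y) - y) := by abel
        rw [this]
        refine (norm_add_le _ _).trans ?_
        have := norm_sub_le (e (κ x) - e (κ y)) (e (κ x) - x)
        linarith
      · refine le_add_left (le_add_left ?_)
        rw [hgR y hy]
        refine ENNReal.ofReal_le_ofReal ?_
        nlinarith
      · refine le_add_left (le_add_right ?_)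
        rw [hgR x hx]
        refine ENNReal.ofReal_le_ofReal ?_
        nlinarith
      · refine le_add_left ?_
        rw [hgR x hx, hgR y hy, ← ENNReal.ofReal_add (by positivity) (by positivity)]
        refine ENNReal.ofReal_le_ofReal ?_
        nlinarith [sq_nonneg (‖x - x₀‖ - ‖y - x₀‖)]
    refine (lintegral_mono hpt).trans ?_
    rw [lintegral_add_right _ (by fun_prop), lintegral_add_left (by fun_prop)]
    refine add_le_add hcost (le_of_eq ?_)
    rw [← hfst, ← hsnd, lintegral_map hgm measurable_fst, lintegral_map hgm measurable_snd]
  have htail : ∀ ρ : Measure (En n), ∫⁻ x, ENNReal.ofReal (‖x - x₀‖ ^ 2) ∂ρ ≠ ∞ →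
      Filter.Tendsto (fun k : ℕ => ∫⁻ x, {x | (k : ℝ) < ‖x - x₀‖}.indicator
        (fun x => 4 * ENNReal.ofReal (‖x - x₀‖ ^ 2)) x ∂ρ) Filter.atTop (nhds 0) := by
    intro ρ hρ
    rw [← lintegral_zero (μ := ρ)]
    refine tendsto_lintegral_of_dominated_convergence
      (fun x => 4 * ENNReal.ofReal (‖x - x₀‖ ^ 2)) (fun k => ?_) (fun k => ?_) ?_ ?_
    · refine Measurable.indicator (by fun_prop) ?_
      exact measurableSet_lt measurable_const (by fun_prop)
    · exact ae_of_all _ fun x => indicator_le_self _ _ _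
    · rw [lintegral_const_mul _ (by fun_prop)]
      exact ENNReal.mul_ne_top (by norm_num) hρ
    · refine ae_of_all _ fun x => tendsto_const_nhds.congr' ?_
      filter_upwards [Filter.eventually_ge_atTop ⌈‖x - x₀‖⌉₊] with k hk
      rw [indicator_of_notMem]
      simpa using Nat.ceil_le.1 hk
  have hlim : Wp 2 ν μ ^ (2 : ℝ) ≤ ENNReal.ofReal (4 * S) := by
    have h1 : Filter.Tendsto (fun k : ℕ => ENNReal.ofReal (4 * S + 32 * (1 / ((k : ℝ) + 1)) ^ 2) +
      (∫⁻ x, {x | (k : ℝ) < ‖x - x₀‖}.indicator (fun x => 4 * ENNReal.ofReal (‖x - x₀‖ ^ 2)) x ∂ν +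
      ∫⁻ x, {x | (k : ℝ) < ‖x - x₀‖}.indicator
        (fun x => 4 * ENNReal.ofReal (‖x - x₀‖ ^ 2)) x ∂μ)) Filter.atTop
        (nhds (ENNReal.ofReal (4 * S + 32 * 0 ^ 2) + (0 + 0))) := by
      refine Filter.Tendsto.add ?_ ((htail ν hν).add (htail μ hμ))
      refine ENNReal.tendsto_ofReal (Filter.Tendsto.const_add _ (Filter.Tendsto.const_mul _ ?_))
      exact tendsto_one_div_add_atTop_nhds_zero_nat.pow 2
    have := ge_of_tendsto' h1 (fun k => key k _ (by positivity))
    simpa using this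
  have := ENNReal.rpow_le_rpow hlim (z := 1 / 2) (by norm_num)
  rw [← ENNReal.rpow_mul, ENNReal.ofReal_rpow_of_nonneg (by positivity) (by norm_num),
    ← Real.sqrt_eq_rpow] at this
  simpa using this

theorem abs_exp_sub_exp_le {a b B : ℝ} (ha : a ≤ B) (hb : b ≤ B) :
    |exp a - exp b| ≤ exp B * |a - b| := by
  have key : ∀ a b : ℝ, a ≤ B → exp a - exp b ≤ exp B * |a - b| := by
    intro a b ha
    have h1 : exp a - exp b ≤ exp a * (a - b) := by
      have := mul_le_mul_of_nonneg_left (Real.add_one_le_exp (b - a)) (exp_pos a).le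
      rw [← Real.exp_add] at this
      simp only [add_sub_cancel] at this
      linarith
    refine h1.trans ?_
    have := exp_le_exp.2 ha
    have := exp_pos a
    calc exp a * (a - b) ≤ exp a * |a - b| := by gcongr; exact le_abs_self _
      _ ≤ _ := by gcongr
  rw [abs_le]
  refine ⟨?_, key a b ha⟩
  have := key b a hb
  rw [abs_sub_comm] at this
  linarith

theorem LipschitzWith.exists_exp {X : Type*} [PseudoMetricSpace X] {u : X → ℝ} {L : NNReal}
    (hu : LipschitzWith L u) {M : ℝ} (hM : ∀ x, |u x| ≤ M) :
    ∃ K, LipschitzWith K fun x => exp (u x) := by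
  refine ⟨(exp M * L).toNNReal, LipschitzWith.of_dist_le_mul fun x y => ?_⟩
  rw [Real.coe_toNNReal _ (by positivity), Real.dist_eq]
  refine (abs_exp_sub_exp_le (abs_le.1 (hM x)).2 (abs_le.1 (hM y)).2).trans ?_
  rw [mul_assoc, ← Real.dist_eq]
  gcongr
  exact hu.dist_le_mul x y

section Lipschitz

variable {n : ℕ} {μ : Measure (En n)}

theorem Continuous.integrable_of_abs_le [IsFiniteMeasure μ] {g : En n → ℝ} (hg : Continuous g)
    {M : ℝ} (hM : ∀ x, |g x| ≤ M) : Integrable g μ :=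
  Integrable.of_bound hg.aestronglyMeasurable M (ae_of_all _ hM)

theorem LipschitzWith.integrable_norm_fderiv_sq [IsFiniteMeasure μ] {g : En n → ℝ} {L : NNReal}
    (hg : LipschitzWith L g) : Integrable (fun x => ‖fderiv ℝ g x‖ ^ 2) μ := by
  refine Integrable.of_bound ((measurable_fderiv ℝ g).norm.pow_const 2).aestronglyMeasurable
    ((L : ℝ) ^ 2) (ae_of_all _ fun x => ?_)
  rw [Real.norm_of_nonneg (by positivity)]
  exact pow_le_pow_left₀ (norm_nonneg _) (norm_fderiv_le_of_lipschitz ℝ hg) 2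

/-- A Poincaré inequality together with a weighted energy bound for `‖x - x₀‖²` give a
logarithmic Sobolev inequality restricted to densities with at most quadratic logarithm. -/
theorem entropy_exp_le_of_poincare [IsProbabilityMeasure μ] (hμ : μ ≪ volume) (x₀ : En n)
    {b c C m l : ℝ} (hb : 0 ≤ b) (hc : 0 < c) (hm : 0 ≤ m) (hl : 0 ≤ l)
    (hLyap : ∀ (g : En n → ℝ) (L : NNReal) (M : ℝ), LipschitzWith L g → (∀ x, |g x| ≤ M) →
      Integrable (fun x => ‖x - x₀‖ ^ 2 * g x ^ 2) μ ∧
      c * ∫ x, ‖x - x₀‖ ^ 2 * g x ^ 2 ∂μ ≤ ∫ x, ‖fderiv ℝ g x‖ ^ 2 ∂μ + b * ∫ x, g x ^ 2 ∂μ)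
    (hP : ∀ (g : En n → ℝ) (L : NNReal) (M : ℝ), LipschitzWith L g → (∀ x, |g x| ≤ M) →
      ∫ x, g x ^ 2 ∂μ - (∫ x, g x ∂μ) ^ 2 ≤ C * ∫ x, ‖fderiv ℝ g x‖ ^ 2 ∂μ)
    {u : En n → ℝ} {L : NNReal} {M : ℝ} (hu : LipschitzWith L u) (hM : ∀ x, |u x| ≤ M)
    (hquad : ∀ x, u x ≤ l * (‖x - x₀‖ ^ 2 + m)) (hone : 1 ≤ ∫ x, exp (u x) ∂μ) :
    ∫ x, u x * exp (u x) ∂μ - (∫ x, exp (u x) ∂μ) * log (∫ x, exp (u x) ∂μ) ≤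
      ((9 + 4 * l * (m + b / c)) * (2 * C) + 4 * l / c) / 4 *
        ∫ x, ‖fderiv ℝ u x‖ ^ 2 * exp (u x) ∂μ := by
  set A := ∫ x, exp (u x) ∂μ with hA
  have hA0 : 0 < A := by linarith
  have hlogA : 0 ≤ log A := log_nonneg hone
  set v : En n → ℝ := fun x => u x - log A with hv
  have hexpv : ∀ x, exp (v x) = A⁻¹ * exp (u x) := by
    intro x; rw [hv]; simp only; rw [exp_sub, exp_log hA0]; ring
  set G : En n → ℝ := fun x => exp (v x / 2) with hG
  have hG0 : ∀ x, 0 < G x := fun x => exp_pos _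
  have hG2 : ∀ x, G x ^ 2 = exp (v x) := by
    intro x; rw [hG]; simp only; rw [← exp_nat_mul]; congr 1; push_cast; ring
  have hvL : LipschitzWith (1 * L) (fun x => v x / 2) := by
    refine LipschitzWith.of_dist_le_mul fun x y => ?_
    have := hu.dist_le_mul x y
    rw [Real.dist_eq] at this ⊢
    have e : v x / 2 - v y / 2 = (u x - u y) / 2 := by simp only [hv]; ring
    rw [e, abs_div, abs_two, one_mul]
    have := abs_nonneg (u x - u y)
    linarith
  have hvM : ∀ x, |v x / 2| ≤ M + log A := by
    intro x
    have h1 := hM x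
    rw [abs_le] at h1 ⊢
    have h2 := (abs_nonneg _).trans (hM x)
    simp only [hv]
    constructor <;> linarith
  obtain ⟨K, hGL⟩ := hvL.exists_exp hvM
  set N := exp (M + log A) with hN
  have hGN : ∀ x, G x ≤ N := fun x => exp_le_exp.2 (le_of_abs_le (hvM x))
  have hGL1 : LipschitzWith K (fun x => G x - 1) := by
    refine LipschitzWith.of_dist_le_mul fun x y => ?_
    have := hGL.dist_le_mul x y
    rw [Real.dist_eq] at this ⊢
    simpa [hG] using this
  have hGM1 : ∀ x, |G x - 1| ≤ N + 1 := by
    intro x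
    rw [abs_le]
    constructor <;> linarith [hG0 x, hGN x]
  have hGM : ∀ x, |G x| ≤ N := fun x => by rw [abs_of_pos (hG0 x)]; exact hGN x
  have hGc : Continuous G := hGL.continuous
  have huc := hu.continuous
  have hvc : Continuous v := huc.sub continuous_const
  have iG : Integrable G μ := hGc.integrable_of_abs_le hGM
  have iG2 : Integrable (fun x => G x ^ 2) μ :=
    Continuous.integrable_of_abs_le (by fun_prop) (M := N ^ 2) fun x => by
      rw [abs_pow]; exact pow_le_pow_left₀ (abs_nonneg _) (hGM x) 2
  have iG1 : Integrable (fun x => (G x - 1) ^ 2) μ :=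
    Continuous.integrable_of_abs_le (by fun_prop) (M := (N + 1) ^ 2) fun x => by
      rw [abs_pow]; exact pow_le_pow_left₀ (abs_nonneg _) (hGM1 x) 2
  have ieu : Integrable (fun x => exp (u x)) μ :=
    Continuous.integrable_of_abs_le (by fun_prop) (M := exp M) fun x => by
      rw [abs_of_pos (exp_pos _)]; exact exp_le_exp.2 (le_of_abs_le (hM x))
  have iueu : Integrable (fun x => u x * exp (u x)) μ :=
    Continuous.integrable_of_abs_le (by fun_prop) (M := M * exp M) fun x => by
      rw [abs_mul, abs_of_pos (exp_pos _)]
      exact mul_le_mul (hM x) (exp_le_exp.2 (le_of_abs_le (hM x))) (exp_pos _).le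
        ((abs_nonneg _).trans (hM x))
  have hGsq : ∫ x, G x ^ 2 ∂μ = 1 := by
    simp only [hG2, hexpv]
    rw [integral_const_mul, ← hA, inv_mul_cancel₀ hA0.ne']
  have hent : ∫ x, u x * exp (u x) ∂μ - A * log A =
      A * ∫ x, (G x ^ 2 * v x - G x ^ 2 + 1) ∂μ := by
    have e : ∀ x, G x ^ 2 * v x - G x ^ 2 + 1 =
        A⁻¹ * (u x * exp (u x)) - A⁻¹ * ((log A + 1) * exp (u x)) + 1 := by
      intro x; rw [hG2, hexpv]; simp only [hv]; ring
    simp only [e]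
    have i1 : Integrable (fun x => A⁻¹ * (u x * exp (u x))) μ := iueu.const_mul _
    have i2 : Integrable (fun x => A⁻¹ * ((log A + 1) * exp (u x))) μ :=
      (ieu.const_mul _).const_mul _
    have i3 : Integrable (fun x => A⁻¹ * (u x * exp (u x)) - A⁻¹ * ((log A + 1) * exp (u x))) μ :=
      i1.sub i2
    rw [integral_add i3 (integrable_const _), integral_sub i1 i2]
    simp only [integral_const_mul, integral_const, probReal_univ, one_smul, ← hA]
    field_simp
    ring
  obtain ⟨iD, hD⟩ := hLyap _ _ _ hGL1 hGM1
  have hpt : ∀ x, G x ^ 2 * v x - G x ^ 2 + 1 ≤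
      (9 + 4 * l * m) * (G x - 1) ^ 2 + 4 * l * (‖x - x₀‖ ^ 2 * (G x - 1) ^ 2) := by
    intro x
    have hg := hG0 x
    have hlm : 0 ≤ l * m := by positivity
    rcases le_total (G x) 2 with h2 | h2
    · have h3 : v x ≤ G x ^ 2 - 1 := by
        rw [hG2]; linarith [Real.add_one_le_exp (v x)]
      have h4 : G x ^ 2 * v x ≤ G x ^ 2 * (G x ^ 2 - 1) := by gcongr
      have h5 : (G x + 1) ^ 2 * (G x - 1) ^ 2 ≤ 9 * (G x - 1) ^ 2 := by
        gcongr; nlinarith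
      have h6 : 0 ≤ 4 * l * m * (G x - 1) ^ 2 := by positivity
      have h7 : 0 ≤ 4 * l * (‖x - x₀‖ ^ 2 * (G x - 1) ^ 2) := by positivity
      nlinarith
    · have h3 : v x ≤ l * (‖x - x₀‖ ^ 2 + m) := by
        have := hquad x; simp only [hv]; linarith
      have h4 : G x ^ 2 * v x ≤ G x ^ 2 * (l * (‖x - x₀‖ ^ 2 + m)) := by gcongr
      have h5 : G x ^ 2 ≤ 4 * (G x - 1) ^ 2 := by nlinarith
      have h6 : G x ^ 2 * (l * (‖x - x₀‖ ^ 2 + m)) ≤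
          4 * (G x - 1) ^ 2 * (l * (‖x - x₀‖ ^ 2 + m)) := by gcongr
      have h7 : 0 ≤ 9 * (G x - 1) ^ 2 := by positivity
      nlinarith
  have iL : Integrable (fun x => G x ^ 2 * v x - G x ^ 2 + 1) μ := by
    refine (Integrable.sub ?_ iG2).add (integrable_const _)
    refine Continuous.integrable_of_abs_le (by fun_prop) (M := N ^ 2 * (2 * (M + log A)))
      fun x => ?_
    rw [abs_mul, abs_pow]
    refine mul_le_mul (pow_le_pow_left₀ (abs_nonneg _) (hGM x) 2) ?_ (abs_nonneg _)
      (by positivity)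
    have := hvM x
    rw [abs_div, abs_two] at this
    linarith
  have hI1 : ∫ x, (G x ^ 2 * v x - G x ^ 2 + 1) ∂μ ≤
      (9 + 4 * l * m) * ∫ x, (G x - 1) ^ 2 ∂μ +
        4 * l * ∫ x, ‖x - x₀‖ ^ 2 * (G x - 1) ^ 2 ∂μ := by
    rw [← integral_const_mul, ← integral_const_mul,
      ← integral_add (iG1.const_mul _) (iD.const_mul _)]
    exact integral_mono iL ((iG1.const_mul _).add (iD.const_mul _)) hpt
  have hfd1 : ∀ x, fderiv ℝ (fun x => G x - 1) x = fderiv ℝ G x := fun x => by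
    rw [fderiv_sub_const]
  simp only [hfd1] at hD
  set E := ∫ x, ‖fderiv ℝ G x‖ ^ 2 ∂μ with hE
  have hE0 : 0 ≤ E := integral_nonneg fun x => by positivity
  have hpoin := hP _ _ _ hGL hGM
  have hvar : ∫ x, (G x - 1) ^ 2 ∂μ ≤ 2 * C * E := by
    have e : ∀ x, (G x - 1) ^ 2 = G x ^ 2 - 2 * G x + 1 := by intro x; ring
    have e2 : ∫ x, (G x - 1) ^ 2 ∂μ = 1 - 2 * (∫ x, G x ∂μ) + 1 := by
      simp only [e]
      have i1 : Integrable (fun x => G x ^ 2 - 2 * G x) μ := iG2.sub (iG.const_mul 2)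
      rw [integral_add i1 (integrable_const _),
        integral_sub iG2 (iG.const_mul 2), integral_const_mul, hGsq]
      simp
    have hG_nonneg : 0 ≤ ∫ x, G x ∂μ := integral_nonneg fun x => (hG0 x).le
    have hpos : 0 ≤ ∫ x, (G x - 1) ^ 2 ∂μ := integral_nonneg fun x => sq_nonneg _
    change ∫ x, G x ^ 2 ∂μ - (∫ x, G x ∂μ) ^ 2 ≤ C * E at hpoin
    rw [hGsq] at hpoin
    rw [e2] at hpos ⊢
    nlinarith
  have hGfd : ∀ᵐ x ∂μ, ‖fderiv ℝ G x‖ ^ 2 = A⁻¹ / 4 * (‖fderiv ℝ u x‖ ^ 2 * exp (u x)) := by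
    filter_upwards [hμ.ae_le hu.ae_differentiableAt] with x hx
    have h1 : HasFDerivAt G (exp (v x / 2) • ((2 : ℝ)⁻¹ • fderiv ℝ u x)) x := by
      have := ((hx.hasFDerivAt.sub_const (log A)).const_mul (2 : ℝ)⁻¹).exp
      have e : G = fun x => exp (2⁻¹ * (u x - log A)) := by
        ext y; simp only [hG, hv]; congr 1; ring
      rw [e]
      have e2 : v x / 2 = 2⁻¹ * (u x - log A) := by simp only [hv]; ring
      rw [e2]
      exact this
    rw [h1.fderiv, norm_smul, norm_smul, mul_pow, Real.norm_of_nonneg (exp_pos _).le]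
    change G x ^ 2 * _ = _
    rw [hG2, hexpv]
    norm_num
    ring
  have hEu : A * E = 1 / 4 * ∫ x, ‖fderiv ℝ u x‖ ^ 2 * exp (u x) ∂μ := by
    rw [hE, integral_congr_ae hGfd, integral_const_mul]
    field_simp
  have hD2 : ∫ x, ‖x - x₀‖ ^ 2 * (G x - 1) ^ 2 ∂μ ≤
      (E + b * ∫ x, (G x - 1) ^ 2 ∂μ) / c := by
    rw [le_div_iff₀ hc]; linarith
  have hfin : ∫ x, (G x ^ 2 * v x - G x ^ 2 + 1) ∂μ ≤
      ((9 + 4 * l * (m + b / c)) * (2 * C) + 4 * l / c) * E := by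
    calc _ ≤ (9 + 4 * l * m) * ∫ x, (G x - 1) ^ 2 ∂μ +
        4 * l * ((E + b * ∫ x, (G x - 1) ^ 2 ∂μ) / c) := by
          refine hI1.trans ?_; gcongr
      _ = (9 + 4 * l * (m + b / c)) * ∫ x, (G x - 1) ^ 2 ∂μ + 4 * l / c * E := by
          field_simp; ring
      _ ≤ (9 + 4 * l * (m + b / c)) * (2 * C * E) + 4 * l / c * E := by gcongr
      _ = _ := by ring
  rw [hent]
  calc _ ≤ A * (((9 + 4 * l * (m + b / c)) * (2 * C) + 4 * l / c) * E) := by gcongr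
    _ = ((9 + 4 * l * (m + b / c)) * (2 * C) + 4 * l / c) * (A * E) := by ring
    _ = _ := by rw [hEu]; ring

end Lipschitz

section Evolution

open Filter Topology

variable {n : ℕ} {μ : Measure (En n)}

theorem norm_gradient_eq (q : En n → ℝ) (x : En n) : ‖gradient q x‖ = ‖fderiv ℝ q x‖ :=
  LinearIsometryEquiv.norm_map _ _

theorem measurable_gradient (q : En n → ℝ) : Measurable (gradient q) :=
  (InnerProductSpace.toDual ℝ (En n)).symm.continuous.measurable.comp (measurable_fderiv ℝ q)

/-- Right derivative at `s = 0` of the exponential moment of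
`l (t + s) (q (x - s ∇q(x)) + s |∇q(x)|² / 2)`. -/
theorem tendsto_slope_integral_exp [IsProbabilityMeasure μ] (hμ : μ ≪ volume) {l t : ℝ}
    (hl : 0 < l) (ht : 0 < t) {q : En n → ℝ} {L : NNReal} {M : ℝ} (hq : LipschitzWith L q)
    (hM : ∀ x, |q x| ≤ M) :
    Tendsto (fun s : ℝ => s⁻¹ * (∫ x, exp (l * (t + s) * (q (x - s • gradient q x) +
        s * ‖gradient q x‖ ^ 2 / 2)) ∂μ - ∫ x, exp (l * t * q x) ∂μ)) (𝓝[>] 0)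
      (𝓝 (∫ x, exp (l * t * q x) * (l * q x - l * t / 2 * ‖fderiv ℝ q x‖ ^ 2) ∂μ)) := by
  have hM0 : 0 ≤ M := (abs_nonneg _).trans (hM 0)
  set g := gradient q with hg
  have hgL : ∀ x, ‖g x‖ ≤ L := fun x => by
    rw [hg, norm_gradient_eq]; exact norm_fderiv_le_of_lipschitz ℝ hq
  have hgm : Measurable g := measurable_gradient q
  set w : ℝ → En n → ℝ := fun s x => l * (t + s) * (q (x - s • g x) + s * ‖g x‖ ^ 2 / 2) with hw
  have hw0 : ∀ x, w 0 x = l * t * q x := fun x => by simp [hw]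
  set B := l * (t + 1) * (M + L ^ 2 / 2) with hB
  have hwm : ∀ s, Measurable (w s) := fun s => by
    have := hq.continuous.measurable
    simp only [hw]
    fun_prop
  have hg2 : ∀ x, ‖g x‖ ^ 2 ≤ (L : ℝ) ^ 2 := fun x => pow_le_pow_left₀ (norm_nonneg _) (hgL x) 2
  have hwB : ∀ s ∈ Icc (0 : ℝ) 1, ∀ x, |w s x| ≤ B := by
    intro s hs x
    simp only [hw, hB]
    rw [abs_mul, abs_of_nonneg (by have := hs.1; positivity : 0 ≤ l * (t + s))]
    have h0 := hs.1
    gcongr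
    · exact hs.2
    · refine (abs_add_le _ _).trans (add_le_add (hM _) ?_)
      rw [abs_of_nonneg (by positivity)]
      have := mul_le_mul hs.2 (hg2 x) (by positivity) zero_le_one
      linarith
  have hdiff : ∀ s ∈ Icc (0 : ℝ) 1, ∀ x, |w s x - w 0 x| ≤
      s * (l * (t + 1) * (L * L) + l * M + l * (t + 1) * (L ^ 2 / 2)) := by
    intro s hs x
    have h0 := hs.1
    have h1 : |q (x - s • g x) - q x| ≤ L * (s * L) := by
      have := hq.dist_le_mul (x - s • g x) x
      rw [Real.dist_eq, dist_eq_norm] at this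
      refine this.trans ?_
      have e : ‖x - s • g x - x‖ = s * ‖g x‖ := by
        rw [sub_sub_cancel_left, norm_neg, norm_smul, Real.norm_of_nonneg h0]
      rw [e]
      gcongr
      exact hgL x
    have e : w s x - w 0 x = l * (t + s) * (q (x - s • g x) - q x) + l * s * q x +
        l * (t + s) * (s * (‖g x‖ ^ 2 / 2)) := by
      rw [hw0]; simp only [hw]; ring
    rw [e]
    have a1 : |l * (t + s) * (q (x - s • g x) - q x)| ≤ l * (t + 1) * (L * (s * L)) := by
      rw [abs_mul, abs_of_nonneg (by positivity : 0 ≤ l * (t + s))]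
      have := hs.2
      gcongr
    have a2 : |l * s * q x| ≤ l * s * M := by
      rw [abs_mul, abs_of_nonneg (by positivity : 0 ≤ l * s)]
      gcongr
      exact hM x
    have a3 : |l * (t + s) * (s * (‖g x‖ ^ 2 / 2))| ≤ l * (t + 1) * (s * (L ^ 2 / 2)) := by
      rw [abs_of_nonneg (by positivity)]
      have := hs.2
      have := hgL x
      gcongr
    have := abs_add_le (l * (t + s) * (q (x - s • g x) - q x) + l * s * q x)
      (l * (t + s) * (s * (‖g x‖ ^ 2 / 2)))
    have := abs_add_le (l * (t + s) * (q (x - s • g x) - q x)) (l * s * q x)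
    linarith
  have hInt : ∀ s ∈ Icc (0 : ℝ) 1, Integrable (fun x => exp (w s x)) μ := fun s hs =>
    Integrable.of_bound (hwm s).exp.aestronglyMeasurable (exp B) (ae_of_all _ fun x => by
      rw [Real.norm_of_nonneg (exp_pos _).le]
      exact exp_le_exp.2 (abs_le.1 (hwB s hs x)).2)
  have hIoc : ∀ᶠ s : ℝ in 𝓝[>] 0, s ∈ Ioc (0 : ℝ) 1 :=
    Ioc_mem_nhdsGT zero_lt_one
  have hz : (0 : ℝ) ∈ Icc (0 : ℝ) 1 := ⟨le_rfl, zero_le_one⟩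
  have key : Tendsto (fun s : ℝ => ∫ x, s⁻¹ * (exp (w s x) - exp (w 0 x)) ∂μ) (𝓝[>] 0)
      (𝓝 (∫ x, exp (l * t * q x) * (l * q x - l * t / 2 * ‖fderiv ℝ q x‖ ^ 2) ∂μ)) := by
    refine MeasureTheory.tendsto_integral_filter_of_dominated_convergence (fun _ =>
      exp B * (l * (t + 1) * (L * L) + l * M + l * (t + 1) * (L ^ 2 / 2))) ?_ ?_
      (integrable_const _) ?_
    · exact Eventually.of_forall fun s =>
        (((hwm s).exp.sub (hwm 0).exp).const_mul _).aestronglyMeasurable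
    · filter_upwards [hIoc] with s hs
      refine ae_of_all _ fun x => ?_
      have hs' : s ∈ Icc (0 : ℝ) 1 := ⟨hs.1.le, hs.2⟩
      have h1 := abs_exp_sub_exp_le (abs_le.1 (hwB s hs' x)).2 (abs_le.1 (hwB 0 hz x)).2
      rw [Real.norm_eq_abs, abs_mul, abs_of_pos (inv_pos.2 hs.1), inv_mul_le_iff₀ hs.1]
      refine h1.trans ?_
      have := mul_le_mul_of_nonneg_left (hdiff s hs' x) (exp_pos B).le
      linarith
    · filter_upwards [hμ.ae_le hq.ae_differentiableAt] with x hx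
      have h1 : HasDerivAt (fun s : ℝ => x - s • g x) (-g x) 0 := by
        simpa using ((hasDerivAt_id (0 : ℝ)).smul_const (g x)).const_sub x
      have h2 : HasDerivAt (fun s : ℝ => q (x - s • g x)) (-‖g x‖ ^ 2) 0 := by
        have h0 : HasFDerivAt q (fderiv ℝ q x) (x - (0 : ℝ) • g x) := by
          simpa using hx.hasFDerivAt
        have := h0.comp_hasDerivAt (0 : ℝ) h1
        rw [map_neg, ← inner_gradient_left, ← hg, real_inner_self_eq_norm_sq] at this
        exact this
      have h3 : HasDerivAt (fun s : ℝ => w s x) (l * q x - l * t / 2 * ‖fderiv ℝ q x‖ ^ 2) 0 := by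
        have h4 : HasDerivAt (fun s : ℝ => q (x - s • g x) + s * ‖g x‖ ^ 2 / 2)
            (-‖g x‖ ^ 2 + 1 * ‖g x‖ ^ 2 / 2) 0 :=
          h2.add (((hasDerivAt_id (0 : ℝ)).mul_const _).div_const 2)
        have h5 : HasDerivAt (fun s : ℝ => l * (t + s)) (l * 1) 0 :=
          ((hasDerivAt_id (0 : ℝ)).const_add t).const_mul l
        refine (h5.mul h4).congr_deriv ?_
        rw [← norm_gradient_eq, ← hg]
        simp
        ring
      have h4 := h3.exp.tendsto_slope_zero_right
      simp only [zero_add, smul_eq_mul, hw0] at h4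
      simpa only [hw0] using h4
  refine key.congr' ?_
  filter_upwards [hIoc] with s hs
  have e : ∀ x, exp (l * t * q x) = exp (w 0 x) := fun x => by rw [hw0]
  rw [integral_const_mul, integral_sub (hInt s ⟨hs.1.le, hs.2⟩) (hInt 0 hz)]
  simp only [e]
  rfl

/-- Hypercontractivity of the Hopf-Lax semigroup: a restricted logarithmic Sobolev inequality
yields an exponential moment bound for `hopfLax h 1`. -/
theorem integral_exp_hopfLax_le_one [IsProbabilityMeasure μ] (hμ : μ ≪ volume) (x₀ : En n)
    {l : ℝ} (hl : 0 < l) (hD : Integrable (fun x => ‖x - x₀‖ ^ 2) μ)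
    (hLSI : ∀ (u : En n → ℝ) (L : NNReal) (M : ℝ), LipschitzWith L u → (∀ x, |u x| ≤ M) →
      (∀ x, u x ≤ l * (‖x - x₀‖ ^ 2 + ∫ y, ‖y - x₀‖ ^ 2 ∂μ)) → 1 ≤ ∫ x, exp (u x) ∂μ →
      2 * l * (∫ x, u x * exp (u x) ∂μ - (∫ x, exp (u x) ∂μ) * log (∫ x, exp (u x) ∂μ)) ≤
        ∫ x, ‖fderiv ℝ u x‖ ^ 2 * exp (u x) ∂μ)
    {h : En n → ℝ} (hh : Measurable h) {M : ℝ} (hM : ∀ x, |h x| ≤ M) (hmean : ∫ x, h x ∂μ = 0) :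
    ∫ x, exp (l * hopfLax h 1 x) ∂μ ≤ 1 := by
  have hM0 : 0 ≤ M := (abs_nonneg _).trans (hM 0)
  have hcont : ∀ t, 0 < t → Continuous (hopfLax h t) := fun t ht =>
    (exists_lipschitzWith_hopfLax hM ht).choose_spec.continuous
  have ih : Integrable h μ := Integrable.of_bound hh.aestronglyMeasurable M (ae_of_all _ hM)
  set Z : ℝ → ℝ := fun t => ∫ x, exp (l * t * hopfLax h t x) ∂μ with hZ
  have hexpB : ∀ t ∈ Ioc (0 : ℝ) 1, ∀ x, exp (l * t * hopfLax h t x) ≤ exp (l * M) := by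
    intro t ht x
    refine exp_le_exp.2 ?_
    have h1 := abs_le.1 (abs_hopfLax_le hM ht.1 x)
    have h0 := ht.1
    calc l * t * hopfLax h t x ≤ l * t * M := by gcongr; exact h1.2
      _ ≤ l * 1 * M := by gcongr; exact ht.2
      _ = l * M := by ring
  have hexpI : ∀ t ∈ Ioc (0 : ℝ) 1, Integrable (fun x => exp (l * t * hopfLax h t x)) μ := by
    intro t ht
    have := hcont t ht.1
    refine Continuous.integrable_of_abs_le (by fun_prop) (M := exp (l * M)) fun x => ?_
    rw [abs_of_pos (exp_pos _)]
    exact hexpB t ht x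
  have hquad : ∀ t ∈ Ioc (0 : ℝ) 1, ∀ x, l * t * hopfLax h t x ≤
      l * (‖x - x₀‖ ^ 2 + ∫ y, ‖y - x₀‖ ^ 2 ∂μ) := by
    intro t ht x
    have h0 := ht.1
    have h1 : ∀ y, t * hopfLax h t x - ‖x - x₀‖ ^ 2 ≤ t * h y + ‖y - x₀‖ ^ 2 := by
      intro y
      have h2 := mul_le_mul_of_nonneg_left (hopfLax_le hM h0 x y) h0.le
      have h3 : t * (h y + ‖x - y‖ ^ 2 / (2 * t)) = t * h y + ‖x - y‖ ^ 2 / 2 := by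
        field_simp
      have h4 : ‖x - y‖ ≤ ‖x - x₀‖ + ‖y - x₀‖ := by
        have := norm_sub_le (x - x₀) (y - x₀)
        simpa using this
      have h5 : ‖x - y‖ ^ 2 ≤ (‖x - x₀‖ + ‖y - x₀‖) ^ 2 := by gcongr
      nlinarith [sq_nonneg (‖x - x₀‖ - ‖y - x₀‖)]
    have h2 : ∫ _, (t * hopfLax h t x - ‖x - x₀‖ ^ 2) ∂μ ≤ ∫ y, (t * h y + ‖y - x₀‖ ^ 2) ∂μ :=
      integral_mono (integrable_const _) ((ih.const_mul t).add hD) h1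
    rw [integral_add (ih.const_mul t) hD, integral_const_mul, hmean] at h2
    simp only [integral_const, probReal_univ, one_smul] at h2
    rw [mul_assoc]
    gcongr
    linarith
  -- the differential inequality, integrated with a small loss `ε`
  have main : ∀ ε : ℝ, 0 < ε → Z 1 ≤ exp (ε * 1 + ε * 1 ^ 2) := by
    intro ε hε
    obtain ⟨t₀, ht₀, ht₁, hsmall, hsmall2⟩ : ∃ t₀ : ℝ, 0 < t₀ ∧ t₀ ≤ 1 ∧ t₀ * (l * M) ≤ 1 ∧
        t₀ * (l * M) ^ 2 ≤ ε := by
      refine ⟨min 1 (min (1 / (l * M + 1)) (ε / ((l * M) ^ 2 + 1))), by positivity,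
        min_le_left _ _, ?_, ?_⟩
      · calc _ ≤ 1 / (l * M + 1) * (l * M) := by
              gcongr; exact (min_le_right _ _).trans (min_le_left _ _)
          _ ≤ 1 := by rw [div_mul_eq_mul_div, div_le_one (by positivity)]; linarith
      · calc _ ≤ ε / ((l * M) ^ 2 + 1) * (l * M) ^ 2 := by
              gcongr; exact (min_le_right _ _).trans (min_le_right _ _)
          _ ≤ ε := by
              rw [div_mul_eq_mul_div, div_le_iff₀ (by positivity)]; nlinarith
    have hstart : Z t₀ ≤ exp (ε * t₀ + ε * t₀ ^ 2) := by
      have h1 : ∀ x, exp (l * t₀ * hopfLax h t₀ x) ≤ 1 + l * t₀ * h x + ε * t₀ := by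
        intro x
        have h2 : |l * t₀ * h x| ≤ t₀ * (l * M) := by
          rw [abs_mul, abs_of_pos (by positivity)]
          have := mul_le_mul_of_nonneg_left (hM x) (by positivity : 0 ≤ l * t₀)
          linarith
        have h3 := (abs_le.1 (Real.abs_exp_sub_one_sub_id_le (h2.trans hsmall))).2
        have h4 : (l * t₀ * h x) ^ 2 ≤ (t₀ * (l * M)) ^ 2 := sq_le_sq' (abs_le.1 h2).1 (abs_le.1 h2).2
        have h5 : (t₀ * (l * M)) ^ 2 ≤ ε * t₀ := by nlinarith
        have h6 : exp (l * t₀ * hopfLax h t₀ x) ≤ exp (l * t₀ * h x) := by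
          gcongr; exact hopfLax_le_self hM ht₀ x
        linarith
      have h2 : Z t₀ ≤ ∫ x, (1 + l * t₀ * h x + ε * t₀) ∂μ :=
        integral_mono (hexpI t₀ ⟨ht₀, ht₁⟩)
          (((integrable_const _).add (ih.const_mul _)).add (integrable_const _)) h1
      have i1 : Integrable (fun x => 1 + l * t₀ * h x) μ :=
        (integrable_const _).add (ih.const_mul _)
      rw [integral_add i1 (integrable_const _),
        integral_add (integrable_const _) (ih.const_mul _), integral_const_mul, hmean] at h2
      simp only [integral_const, probReal_univ, one_smul] at h2
      have h3 := Real.add_one_le_exp (ε * t₀ + ε * t₀ ^ 2)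
      have : 0 ≤ ε * t₀ ^ 2 := by positivity
      linarith
    have hZc : ContinuousOn Z (Icc t₀ 1) := by
      refine continuousOn_of_dominated (bound := fun _ => exp (l * M)) ?_ ?_
        (integrable_const _) ?_
      · exact fun t ht => (hexpI t ⟨ht₀.trans_le ht.1, ht.2⟩).aestronglyMeasurable
      · intro t ht
        refine ae_of_all _ fun x => ?_
        rw [Real.norm_of_nonneg (exp_pos _).le]
        exact hexpB t ⟨ht₀.trans_le ht.1, ht.2⟩ x
      · refine ae_of_all _ fun x => ?_
        have hQ : ContinuousOn (fun t => hopfLax h t x) (Icc t₀ 1) := by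
          have hl2 : ∀ s ∈ Icc t₀ 1, ∀ t ∈ Icc t₀ 1, s ≤ t →
              |hopfLax h s x - hopfLax h t x| ≤ 2 * M / t₀ * |s - t| := by
            intro s hs t ht hst
            have hs0 := ht₀.trans_le hs.1
            have h1 := hopfLax_anti hM hs0 hst x
            have h2 := hopfLax_le_add hM hs0 hst x
            rw [abs_of_nonneg (by linarith), abs_sub_comm, abs_of_nonneg (by linarith)]
            have h3 : t / s - 1 ≤ (t - s) / t₀ := by
              rw [div_sub_one hs0.ne']
              have := hs.1
              gcongr
            have h4 : 2 * M * (t / s - 1) ≤ 2 * M * ((t - s) / t₀) := by gcongr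
            have h5 : 2 * M * ((t - s) / t₀) = 2 * M / t₀ * (t - s) := by ring
            linarith
          refine (LipschitzOnWith.of_dist_le_mul (K := (2 * M / t₀).toNNReal)
            fun s hs t ht => ?_).continuousOn
          rw [Real.coe_toNNReal _ (by positivity), Real.dist_eq, Real.dist_eq]
          rcases le_total s t with hst | hst
          · exact hl2 s hs t ht hst
          · rw [abs_sub_comm, abs_sub_comm s t]
            exact hl2 t ht s hs hst
        exact ((continuousOn_const.mul continuousOn_id).mul hQ).rexp
    refine image_le_of_liminf_slope_right_lt_deriv_boundary (f := Z)
      (f' := fun t => ∫ x, exp (l * t * hopfLax h t x) * (l * hopfLax h t x -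
        l * t / 2 * ‖fderiv ℝ (hopfLax h t) x‖ ^ 2) ∂μ)
      (B := fun t => exp (ε * t + ε * t ^ 2))
      (B' := fun t => exp (ε * t + ε * t ^ 2) * (ε + 2 * ε * t)) hZc ?_ hstart ?_ ?_
      ⟨ht₁, le_rfl⟩
    · intro t ht r hr
      have htp := ht₀.trans_le ht.1
      obtain ⟨L, hL⟩ := exists_lipschitzWith_hopfLax hM htp
      have hT := tendsto_slope_integral_exp hμ hl htp hL (abs_hopfLax_le hM htp)
      have hmap : map (fun s => t + s) (𝓝[>] (0 : ℝ)) = 𝓝[>] t := by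
        simp
      rw [← hmap, frequently_map]
      refine Eventually.frequently ?_
      filter_upwards [hT.eventually_lt_const hr, self_mem_nhdsWithin,
        Ioc_mem_nhdsGT (sub_pos.2 ht.2)] with s hs hs0 hs1
      have hs0 : 0 < s := hs0
      rw [slope_def_field, add_sub_cancel_left, div_eq_inv_mul]
      refine lt_of_le_of_lt ?_ hs
      gcongr
      set g := gradient (hopfLax h t) with hg
      have hle : ∀ x, hopfLax h (t + s) x ≤
          hopfLax h t (x - s • g x) + s * ‖g x‖ ^ 2 / 2 := by
        intro x
        have := hopfLax_add_le hM htp hs0 x (x - s • g x)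
        rw [sub_sub_cancel, norm_smul, Real.norm_of_nonneg hs0.le] at this
        refine this.trans_eq ?_
        field_simp
      refine integral_mono (hexpI _ ⟨by positivity, by linarith [hs1.2]⟩) ?_ fun x => ?_
      · have hgm : Measurable g := measurable_gradient _
        have hqm := (hcont t htp).measurable
        refine Integrable.of_bound (Measurable.aestronglyMeasurable (by fun_prop))
          (exp (l * (t + s) * (M + s * L ^ 2 / 2))) (ae_of_all _ fun x => ?_)
        rw [Real.norm_of_nonneg (exp_pos _).le]
        have hgL : ‖g x‖ ≤ L := by
          rw [hg, norm_gradient_eq]; exact norm_fderiv_le_of_lipschitz ℝ hL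
        gcongr
        exact (abs_le.1 (abs_hopfLax_le hM htp _)).2
      · simp only
        gcongr
        exact hle x
    · intro t
      have h1 : HasDerivAt (fun t : ℝ => ε * t + ε * t ^ 2) (ε + 2 * ε * t) t := by
        have := ((hasDerivAt_id t).const_mul ε).add (((hasDerivAt_id t).pow 2).const_mul ε)
        refine this.congr_deriv ?_
        simp
        ring
      exact h1.exp
    · intro t ht heq
      have htp := ht₀.trans_le ht.1
      have ht' : t ∈ Ioc (0 : ℝ) 1 := ⟨htp, ht.2.le⟩
      obtain ⟨L, hL⟩ := exists_lipschitzWith_hopfLax hM htp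
      set q := hopfLax h t with hq
      have hqM : ∀ x, |q x| ≤ M := abs_hopfLax_le hM htp
      have hqc : Continuous q := hL.continuous
      set A := exp (ε * t + ε * t ^ 2) with hA
      have hA0 : 0 < A := exp_pos _
      have heq : ∫ x, exp (l * t * q x) ∂μ = A := heq
      have huL : LipschitzWith ((l * t).toNNReal * L) fun x => l * t * q x := by
        refine LipschitzWith.of_dist_le_mul fun x y => ?_
        have := hL.dist_le_mul x y
        rw [Real.dist_eq] at this ⊢
        rw [NNReal.coe_mul, Real.coe_toNNReal _ (by positivity), ← mul_sub, abs_mul,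
          abs_of_pos (by positivity)]
        have := mul_le_mul_of_nonneg_left this (mul_pos hl htp).le
        linarith
      have huM : ∀ x, |l * t * q x| ≤ l * t * M := fun x => by
        rw [abs_mul, abs_of_pos (by positivity)]
        gcongr
        exact hqM x
      have hone : 1 ≤ ∫ x, exp (l * t * q x) ∂μ := by
        rw [heq]; exact one_le_exp (by positivity)
      have hlsi := hLSI _ _ _ huL huM (hquad t ht') hone
      rw [heq, hA, log_exp, ← hA] at hlsi
      have hfd : ∀ x, ‖fderiv ℝ (fun x => l * t * q x) x‖ ^ 2 =
          (l * t) ^ 2 * ‖fderiv ℝ q x‖ ^ 2 := by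
        intro x
        have : (fun x => l * t * q x) = (l * t) • q := rfl
        rw [this, fderiv_const_smul_field, Pi.smul_apply, norm_smul, mul_pow, Real.norm_eq_abs, sq_abs]
      simp only [hfd] at hlsi
      have iq : Integrable (fun x => q x * exp (l * t * q x)) μ := by
        refine Continuous.integrable_of_abs_le (by fun_prop) (M := M * exp (l * M)) fun x => ?_
        rw [abs_mul, abs_of_pos (exp_pos _)]
        exact mul_le_mul (hqM x) (hexpB t ht' x) (exp_pos _).le hM0
      have iF : Integrable (fun x => ‖fderiv ℝ q x‖ ^ 2 * exp (l * t * q x)) μ := by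
        have hfm := measurable_fderiv ℝ q
        have hqm := hqc.measurable
        refine Integrable.of_bound (Measurable.aestronglyMeasurable (by fun_prop))
          (L ^ 2 * exp (l * M)) (ae_of_all _ fun x => ?_)
        rw [Real.norm_of_nonneg (by positivity)]
        have := norm_fderiv_le_of_lipschitz ℝ hL (x₀ := x)
        have := hexpB t ht' x
        gcongr
      have e1 : ∫ x, l * t * q x * exp (l * t * q x) ∂μ =
          l * t * ∫ x, q x * exp (l * t * q x) ∂μ := by
        rw [← integral_const_mul]; congr 1; ext x; ring
      have e2 : ∫ x, (l * t) ^ 2 * ‖fderiv ℝ q x‖ ^ 2 * exp (l * t * q x) ∂μ =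
          (l * t) ^ 2 * ∫ x, ‖fderiv ℝ q x‖ ^ 2 * exp (l * t * q x) ∂μ := by
        rw [← integral_const_mul]; congr 1; ext x; ring
      have e3 : ∫ x, exp (l * t * q x) * (l * q x - l * t / 2 * ‖fderiv ℝ q x‖ ^ 2) ∂μ =
          l * ∫ x, q x * exp (l * t * q x) ∂μ -
            l * t / 2 * ∫ x, ‖fderiv ℝ q x‖ ^ 2 * exp (l * t * q x) ∂μ := by
        rw [← integral_const_mul, ← integral_const_mul,
          ← integral_sub (iq.const_mul _) (iF.const_mul _)]
        congr 1; ext x; ring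
      rw [e1, e2] at hlsi
      change ∫ x, exp (l * t * q x) * (l * q x - l * t / 2 * ‖fderiv ℝ q x‖ ^ 2) ∂μ < _
      rw [e3]
      set X := ∫ x, q x * exp (l * t * q x) ∂μ
      set Y := ∫ x, ‖fderiv ℝ q x‖ ^ 2 * exp (l * t * q x) ∂μ
      have h1 : 2 * l * t * (l * X - l * t / 2 * Y) ≤ 2 * l * t * (A * (ε + ε * t)) := by
        linarith
      have h2 := le_of_mul_le_mul_left h1 (by positivity)
      have h3 : 0 < A * (ε * t) := by positivity
      linarith
  have hlim : Tendsto (fun ε : ℝ => exp (ε * 1 + ε * 1 ^ 2)) (𝓝[>] 0) (𝓝 1) := by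
    have : Continuous fun ε : ℝ => exp (ε * 1 + ε * 1 ^ 2) := by fun_prop
    have := this.tendsto 0
    simp only [zero_mul, add_zero, exp_zero] at this
    exact this.mono_left nhdsWithin_le_nhds
  have := ge_of_tendsto hlim (Filter.eventually_of_mem self_mem_nhdsWithin main)
  simpa [hZ] using this

end Evolution

section IntegrationByParts

variable {n : ℕ}

theorem LipschitzWith.integrable_mul_fderiv {φ G : En n → ℝ} (hφ : Continuous φ) {L : NNReal}
    (hG : LipschitzWith L G) (hGs : HasCompactSupport G) (v : En n) :
    Integrable (fun x => φ x * fderiv ℝ G x v) := by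
  have hsupp : Function.support (fun x => φ x * fderiv ℝ G x v) ⊆ tsupport G := by
    intro x hx
    refine support_fderiv_subset ℝ (f := G) fun h0 => hx ?_
    simp [h0]
  rw [← integrableOn_iff_integrable_of_support_subset hsupp]
  refine (hφ.continuousOn.integrableOn_compact hGs).mul_bdd (c := (L : ℝ) * ‖v‖)
    (measurable_fderiv_apply_const ℝ G v).aestronglyMeasurable (ae_of_all _ fun x => ?_)
  refine ((fderiv ℝ G x).le_opNorm v).trans ?_
  gcongr
  exact norm_fderiv_le_of_lipschitz ℝ hG

/-- Integration by parts of a `C¹` function against a compactly supported Lipschitz function. -/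
theorem integral_fderiv_mul_eq_neg_of_lipschitzWith {φ G : En n → ℝ} (hφ : ContDiff ℝ 1 φ)
    {L : NNReal} (hG : LipschitzWith L G) (hGs : HasCompactSupport G) (v : En n) :
    ∫ x, fderiv ℝ φ x v * G x = - ∫ x, φ x * fderiv ℝ G x v := by
  obtain ⟨R, hR⟩ := hGs.isCompact.isBounded.subset_ball (0 : En n)
  obtain ⟨R', hR'0, hRR'⟩ : ∃ R', 0 < R' ∧ R ≤ R' := ⟨max R 1, by positivity, le_max_left _ _⟩
  have hsub : tsupport G ⊆ Metric.ball (0 : En n) R' :=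
    hR.trans (Metric.ball_subset_ball hRR')
  let χ : ContDiffBump (0 : En n) := ⟨R', R' + 1, hR'0, by linarith⟩
  have hχφ : ContDiff ℝ 1 fun x => χ x * φ x := χ.contDiff.mul hφ
  obtain ⟨C, hC⟩ : ∃ C, LipschitzWith C fun x => χ x * φ x := hχφ.lipschitzWith_of_hasCompactSupport χ.hasCompactSupport.mul_right one_ne_zero
  have key := hC.integral_lineDeriv_mul_eq (μ := volume) hG hGs v
  have hone : ∀ x ∈ tsupport G, (fun x => χ x * φ x) =ᶠ[nhds x] φ := by
    intro x hx
    filter_upwards [χ.eventuallyEq_one_of_mem_ball (hsub hx)] with y hy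
    rw [hy]; simp
  have e1 : ∀ x, lineDeriv ℝ (fun x => χ x * φ x) x v * G x = fderiv ℝ φ x v * G x := by
    intro x
    by_cases hx : x ∈ tsupport G
    · rw [((hχφ.differentiable one_ne_zero) x).lineDeriv_eq_fderiv, (hone x hx).fderiv_eq]
    · rw [image_eq_zero_of_notMem_tsupport hx, mul_zero, mul_zero]
  have e2 : ∀ᵐ x : En n, lineDeriv ℝ G x (-v) * (χ x * φ x) = -(φ x * fderiv ℝ G x v) := by
    filter_upwards [hG.ae_differentiableAt] with x hx
    rw [hx.lineDeriv_eq_fderiv, map_neg]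
    by_cases hxs : x ∈ tsupport G
    · rw [(hone x hxs).eq_of_nhds]; ring
    · have : fderiv ℝ G x = 0 := by
        by_contra h0
        exact hxs (support_fderiv_subset ℝ h0)
      simp [this]
  rw [integral_congr_ae (ae_of_all _ e1), integral_congr_ae e2, integral_neg] at key
  exact key

theorem sum_sq_apply_single (l : En n →L[ℝ] ℝ) :
    ∑ i, (l (EuclideanSpace.single i 1)) ^ 2 = ‖l‖ ^ 2 := by
  have h := (EuclideanSpace.basisFun (Fin n) ℝ).sum_sq_norm_inner_left
    ((InnerProductSpace.toDual ℝ (En n)).symm l)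
  rw [LinearIsometryEquiv.norm_map] at h
  rw [← h]
  refine Finset.sum_congr rfl fun i _ => ?_
  rw [Real.norm_eq_abs, sq_abs, InnerProductSpace.toDual_symm_apply]
  simp

theorem inner_gradient_eq_sum (f g : En n → ℝ) (x : En n) :
    ⟪gradient f x, gradient g x⟫ =
      ∑ i, fderiv ℝ f x (EuclideanSpace.single i 1) * fderiv ℝ g x (EuclideanSpace.single i 1) := by
  rw [← (EuclideanSpace.basisFun (Fin n) ℝ).sum_inner_mul_inner]
  refine Finset.sum_congr rfl fun i _ => ?_
  rw [inner_gradient_left, real_inner_comm, inner_gradient_left]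
  simp

end IntegrationByParts

section Lyapunov

variable {n : ℕ} {V W : En n → ℝ} {x₀ : En n} {b c : ℝ}

/-- The weighted energy estimate for compactly supported Lipschitz functions. -/
theorem integral_lyapunov_le_of_hasCompactSupport (hV : ContDiff ℝ 2 V) (hW : ContDiff ℝ 2 W)
    (hW1 : ∀ x, 1 ≤ W x) (hVint : Integrable (fun x => exp (-V x)))
    (hLyap : ∀ x, Lop V W x ≤ (-c * ‖x - x₀‖ ^ 2 + b) * W x)
    {g : En n → ℝ} {L : NNReal} (hg : LipschitzWith L g) (hgs : HasCompactSupport g) :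
    ∫ x, exp (-V x) * ((c * ‖x - x₀‖ ^ 2 - b) * g x ^ 2) ≤
      ∫ x, exp (-V x) * ‖fderiv ℝ g x‖ ^ 2 := by
  let e : Fin n → En n := fun i => EuclideanSpace.single i 1
  have hgc := hg.continuous
  obtain ⟨M, hM⟩ := hgs.exists_bound_of_continuous hgc
  have hM0 : 0 ≤ M := (norm_nonneg _).trans (hM 0)
  have hGL : LipschitzWith (2 * M.toNNReal * L) fun x => g x ^ 2 := by
    refine LipschitzWith.of_dist_le_mul fun x y => ?_
    have h1 := hg.dist_le_mul x y
    rw [Real.dist_eq] at h1 ⊢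
    push_cast
    rw [Real.coe_toNNReal _ hM0, sq_sub_sq, abs_mul, mul_assoc]
    refine mul_le_mul ?_ h1 (abs_nonneg _) (by positivity)
    have := hM x
    have := hM y
    rw [Real.norm_eq_abs] at *
    have := abs_add_le (g x) (g y)
    linarith
  have hGs : HasCompactSupport fun x => g x ^ 2 :=
    hgs.comp_left (g := fun t : ℝ => t ^ 2) (by simp)
  have hWpos : ∀ x, 0 < W x := fun x => zero_lt_one.trans_le (hW1 x)
  have hdW : ∀ i, ContDiff ℝ 1 fun y => fderiv ℝ W y (e i) := fun i =>
    (hW.fderiv_right (m := 1) (by norm_num)).clm_apply contDiff_const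
  let φ : Fin n → En n → ℝ := fun i y => exp (-V y) * (fderiv ℝ W y (e i) / W y)
  have hφ : ∀ i, ContDiff ℝ 1 (φ i) := fun i =>
    ((hV.of_le (by norm_num)).neg.exp).mul
      ((hdW i).div (hW.of_le (by norm_num)) fun x => (hWpos x).ne')
  have hφd : ∀ i x, fderiv ℝ (φ i) x (e i) = exp (-V x) *
      (-(fderiv ℝ V x (e i)) * (fderiv ℝ W x (e i) / W x) +
        (fderiv ℝ (fun y => fderiv ℝ W y (e i)) x (e i) / W x -
          (fderiv ℝ W x (e i)) ^ 2 / W x ^ 2)) := by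
    intro i x
    have dV : HasFDerivAt V (fderiv ℝ V x) x :=
      (hV.differentiable (by norm_num) x).hasFDerivAt
    have dW : HasFDerivAt W (fderiv ℝ W x) x :=
      (hW.differentiable (by norm_num) x).hasFDerivAt
    have ddW := ((hdW i).differentiable one_ne_zero x).hasFDerivAt
    have h := dV.neg.exp.mul (ddW.fun_mul ((hasDerivAt_inv (hWpos x).ne').comp_hasFDerivAt x dW))
    have h' : HasFDerivAt (φ i) _ x := h
    rw [h'.fderiv]
    have := (hWpos x).ne'
    simp
    field_simp
    ring
  have hsum : ∀ x, ∑ i, fderiv ℝ (φ i) x (e i) = exp (-V x) *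
      (Lop V W x / W x - ∑ i, (fderiv ℝ W x (e i) / W x) ^ 2) := by
    intro x
    have := (hWpos x).ne'
    rw [Lop, lapl, inner_gradient_eq_sum, sub_div, Finset.sum_div, Finset.sum_div,
      ← Finset.sum_sub_distrib, ← Finset.sum_sub_distrib, Finset.mul_sum]
    refine Finset.sum_congr rfl fun i _ => ?_
    rw [hφd]
    simp only [e, div_pow]
    ring
  have hφc : ∀ i, Continuous fun x => fderiv ℝ (φ i) x (e i) := fun i =>
    ((hφ i).continuous_fderiv one_ne_zero).clm_apply continuous_const
  have i1 : ∀ i, Integrable fun x => fderiv ℝ (φ i) x (e i) * g x ^ 2 := fun i =>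
    Continuous.integrable_of_hasCompactSupport ((hφc i).mul hGL.continuous) hGs.mul_left
  have i2 : ∀ i, Integrable fun x => φ i x * fderiv ℝ (fun x => g x ^ 2) x (e i) := fun i =>
    hGL.integrable_mul_fderiv (hφ i).continuous hGs _
  have i3 : Integrable fun x => exp (-V x) * ‖fderiv ℝ g x‖ ^ 2 := by
    refine hVint.mul_bdd (c := (L : ℝ) ^ 2) ((measurable_fderiv ℝ g).norm.pow_const 2).aestronglyMeasurable
      (ae_of_all _ fun x => ?_)
    rw [Real.norm_of_nonneg (by positivity)]
    exact pow_le_pow_left₀ (norm_nonneg _) (norm_fderiv_le_of_lipschitz ℝ hg) 2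
  have i4 : Integrable fun x => exp (-V x) * ((c * ‖x - x₀‖ ^ 2 - b) * g x ^ 2) := by
    have := hV.continuous
    refine Continuous.integrable_of_hasCompactSupport (by fun_prop) ?_
    exact (hGs.mul_left).mul_left
  have i12 : ∀ i, Integrable fun x => fderiv ℝ (φ i) x (e i) * g x ^ 2 +
      φ i x * fderiv ℝ (fun x => g x ^ 2) x (e i) := fun i => (i1 i).add (i2 i)
  have hzero : ∫ x, ∑ i, (fderiv ℝ (φ i) x (e i) * g x ^ 2 +
      φ i x * fderiv ℝ (fun x => g x ^ 2) x (e i)) = 0 := by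
    rw [integral_finsetSum _ fun i _ => i12 i]
    refine Finset.sum_eq_zero fun i _ => ?_
    rw [integral_add (i1 i) (i2 i),
      integral_fderiv_mul_eq_neg_of_lipschitzWith (hφ i) hGL hGs]
    ring
  have i5 : Integrable fun x => ∑ i, (fderiv ℝ (φ i) x (e i) * g x ^ 2 +
      φ i x * fderiv ℝ (fun x => g x ^ 2) x (e i)) :=
    integrable_finsetSum _ fun i _ => i12 i
  have hpt : ∀ᵐ x : En n, exp (-V x) * ((c * ‖x - x₀‖ ^ 2 - b) * g x ^ 2) ≤
      exp (-V x) * ‖fderiv ℝ g x‖ ^ 2 - ∑ i, (fderiv ℝ (φ i) x (e i) * g x ^ 2 +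
        φ i x * fderiv ℝ (fun x => g x ^ 2) x (e i)) := by
    filter_upwards [hg.ae_differentiableAt] with x hx
    have hd : ∀ i, fderiv ℝ (fun x => g x ^ 2) x (e i) = 2 * g x * fderiv ℝ g x (e i) := by
      intro i
      rw [(hx.hasFDerivAt.pow 2).fderiv]
      simp
    simp only [hd]
    rw [Finset.sum_add_distrib, ← Finset.sum_mul, hsum, ← sum_sq_apply_single]
    have hL : c * ‖x - x₀‖ ^ 2 - b ≤ -(Lop V W x / W x) := by
      have := (div_le_iff₀ (hWpos x)).2 (hLyap x)
      linarith
    have hsq : 0 ≤ ∑ i, (fderiv ℝ g x (e i) - g x * (fderiv ℝ W x (e i) / W x)) ^ 2 :=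
      Finset.sum_nonneg fun i _ => sq_nonneg _
    have hexp : ∑ i, (fderiv ℝ g x (e i) - g x * (fderiv ℝ W x (e i) / W x)) ^ 2 =
        ∑ i, (fderiv ℝ g x (e i)) ^ 2 -
          ∑ i, (fderiv ℝ W x (e i) / W x) * (2 * g x * fderiv ℝ g x (e i)) +
          g x ^ 2 * ∑ i, (fderiv ℝ W x (e i) / W x) ^ 2 := by
      rw [Finset.mul_sum, ← Finset.sum_sub_distrib, ← Finset.sum_add_distrib]
      exact Finset.sum_congr rfl fun i _ => by ring
    have hφs : ∑ i, φ i x * (2 * g x * fderiv ℝ g x (e i)) =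
        exp (-V x) * ∑ i, (fderiv ℝ W x (e i) / W x) * (2 * g x * fderiv ℝ g x (e i)) := by
      rw [Finset.mul_sum]
      exact Finset.sum_congr rfl fun i _ => by simp only [φ]; ring
    rw [hφs]
    have h1 := mul_le_mul_of_nonneg_right hL (sq_nonneg (g x))
    have h2 := mul_le_mul_of_nonneg_left (add_le_add h1 hsq) (exp_pos (-V x)).le
    rw [hexp] at h2
    simp only [e] at h2 ⊢
    linarith
  have := integral_mono_ae i4 (i3.sub i5) hpt
  simp only [Pi.sub_apply] at this
  rw [integral_sub i3 i5, hzero, sub_zero] at this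
  exact this

end Lyapunov

section Boltz

variable {n : ℕ} {V : En n → ℝ}

theorem boltz_absolutelyContinuous (V : En n → ℝ) : boltz V ≪ volume :=
  withDensity_absolutelyContinuous _ _

theorem integral_exp_neg_pos (hVint : Integrable (fun x => exp (-V x))) :
    0 < ∫ x, exp (-V x) :=
  integral_exp_pos hVint

theorem isProbabilityMeasure_boltz (hVint : Integrable (fun x => exp (-V x))) :
    IsProbabilityMeasure (boltz V) := by
  have hZ := integral_exp_neg_pos hVint
  refine ⟨?_⟩
  rw [boltz, withDensity_apply _ MeasurableSet.univ, Measure.restrict_univ,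
    ← ofReal_integral_eq_lintegral_ofReal (hVint.div_const _)
      (ae_of_all _ fun x => by positivity), integral_div, div_self hZ.ne', ENNReal.ofReal_one]

theorem integral_boltz (hV : Continuous V) (hVint : Integrable (fun x => exp (-V x)))
    (g : En n → ℝ) :
    ∫ x, g x ∂(boltz V) = (∫ x, exp (-V x))⁻¹ * ∫ x, exp (-V x) * g x := by
  have hZ := integral_exp_neg_pos hVint
  rw [boltz, integral_withDensity_eq_integral_toReal_smul (by fun_prop) (by simp),
    ← integral_const_mul]
  refine integral_congr_ae (ae_of_all _ fun x => ?_)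
  simp only [smul_eq_mul]
  rw [ENNReal.toReal_ofReal (by positivity)]
  ring

/-- A Lipschitz cutoff equal to one on the ball of radius `r` and vanishing outside the ball of
radius `2 r`. -/
def ballCutoff (x₀ : En n) (r : ℝ) (x : En n) : ℝ := max 0 (min 1 (2 - ‖x - x₀‖ / r))

variable (x₀ : En n) {r : ℝ}

theorem ballCutoff_nonneg (r : ℝ) (x : En n) : 0 ≤ ballCutoff x₀ r x := le_max_left _ _

theorem ballCutoff_le_one (r : ℝ) (x : En n) : ballCutoff x₀ r x ≤ 1 :=
  max_le zero_le_one (min_le_left _ _)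

theorem ballCutoff_eq_one (hr : 0 < r) {x : En n} (hx : ‖x - x₀‖ ≤ r) :
    ballCutoff x₀ r x = 1 := by
  have : ‖x - x₀‖ / r ≤ 1 := (div_le_one hr).2 hx
  rw [ballCutoff, min_eq_left (by linarith), max_eq_right zero_le_one]

theorem hasCompactSupport_ballCutoff (hr : 0 < r) : HasCompactSupport (ballCutoff x₀ r) := by
  refine HasCompactSupport.of_support_subset_isCompact (isCompact_closedBall x₀ (2 * r))
    fun x hx => ?_
  rw [mem_closedBall_iff_norm]
  by_contra! h
  refine hx (max_eq_left ((min_le_right _ _).trans ?_))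
  have : 2 < ‖x - x₀‖ / r := (lt_div_iff₀ hr).2 h
  linarith

theorem lipschitzWith_ballCutoff (hr : 0 < r) :
    LipschitzWith (1 / r).toNNReal (ballCutoff x₀ r) := by
  refine LipschitzWith.const_max (LipschitzWith.const_min ?_ 1) 0
  refine LipschitzWith.of_dist_le_mul fun x y => ?_
  rw [Real.coe_toNNReal _ (by positivity), Real.dist_eq, dist_eq_norm]
  have e : 2 - ‖x - x₀‖ / r - (2 - ‖y - x₀‖ / r) = 1 / r * (‖y - x₀‖ - ‖x - x₀‖) := by ring
  rw [e, abs_mul, abs_of_pos (by positivity : 0 < 1 / r)]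
  have := abs_norm_sub_norm_le (y - x₀) (x - x₀)
  rw [sub_sub_sub_cancel_right, norm_sub_rev y x] at this
  gcongr

end Boltz

section Lyapunov

open Filter Topology

variable {n : ℕ} {V W : En n → ℝ} {x₀ : En n} {b c : ℝ}

/-- Weighted energy estimate under the Lyapunov condition. -/
theorem lyapunov_integral_le (hV : ContDiff ℝ 2 V) (hW : ContDiff ℝ 2 W)
    (hW1 : ∀ x, 1 ≤ W x) (hVint : Integrable (fun x => exp (-V x))) (hc : 0 < c) (hb : 0 ≤ b)
    (hLyap : ∀ x, Lop V W x ≤ (-c * ‖x - x₀‖ ^ 2 + b) * W x)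
    {g : En n → ℝ} {L : NNReal} {M : ℝ} (hg : LipschitzWith L g) (hM : ∀ x, |g x| ≤ M) :
    Integrable (fun x => ‖x - x₀‖ ^ 2 * g x ^ 2) (boltz V) ∧
      c * ∫ x, ‖x - x₀‖ ^ 2 * g x ^ 2 ∂(boltz V) ≤
        ∫ x, ‖fderiv ℝ g x‖ ^ 2 ∂(boltz V) + b * ∫ x, g x ^ 2 ∂(boltz V) := by
  have := isProbabilityMeasure_boltz hVint
  have hM0 : 0 ≤ M := (abs_nonneg _).trans (hM 0)
  have hgc := hg.continuous
  set μ := boltz V with hμ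
  set E := ∫ x, ‖fderiv ℝ g x‖ ^ 2 ∂μ with hE
  set F := ∫ x, g x ^ 2 ∂μ with hF
  have iF : Integrable (fun x => g x ^ 2) μ :=
    Continuous.integrable_of_abs_le (by fun_prop) (M := M ^ 2) fun x => by
      rw [abs_pow]; exact pow_le_pow_left₀ (abs_nonneg _) (hM x) 2
  have iE := hg.integrable_norm_fderiv_sq (μ := μ)
  have hon : ∀ r : ℝ, IntegrableOn (fun x => ‖x - x₀‖ ^ 2 * g x ^ 2) (Metric.closedBall x₀ r) μ :=
    fun r => (by fun_prop : Continuous fun x => ‖x - x₀‖ ^ 2 * g x ^ 2).continuousOn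
      |>.integrableOn_compact (isCompact_closedBall x₀ r)
  have key : ∀ r : ℝ, 0 < r → c * ∫ x in Metric.closedBall x₀ r, ‖x - x₀‖ ^ 2 * g x ^ 2 ∂μ ≤
      E + (2 * L * M / r + M ^ 2 / r ^ 2) + b * F := by
    intro r hr
    set χ := ballCutoff x₀ r with hχ
    have hχL := lipschitzWith_ballCutoff x₀ hr
    have hχ0 := ballCutoff_nonneg x₀ r
    have hχ1 := ballCutoff_le_one x₀ r
    have hχc : Continuous χ := hχL.continuous
    have hχg : LipschitzWith (L + M.toNNReal * (1 / r).toNNReal) fun x => χ x * g x := by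
      refine LipschitzWith.of_dist_le_mul fun x y => ?_
      have h1 := hg.dist_le_mul x y
      have h2 := hχL.dist_le_mul x y
      rw [Real.dist_eq] at h1 h2 ⊢
      push_cast
      rw [Real.coe_toNNReal _ hM0]
      have e : χ x * g x - χ y * g y = χ x * (g x - g y) + g y * (χ x - χ y) := by ring
      rw [e]
      refine (abs_add_le _ _).trans ?_
      rw [abs_mul, abs_mul, add_mul]
      refine add_le_add ?_ ?_
      · rw [abs_of_nonneg (hχ0 x)]
        exact (mul_le_mul (hχ1 x) h1 (abs_nonneg _) zero_le_one).trans_eq (one_mul _)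
      · rw [mul_assoc]
        exact mul_le_mul (hM y) h2 (abs_nonneg _) hM0
    have hχs : HasCompactSupport χ := hasCompactSupport_ballCutoff x₀ hr
    have hχgs : HasCompactSupport fun x => χ x * g x := hχs.mul_right
    have hmain := integral_lyapunov_le_of_hasCompactSupport hV hW hW1 hVint hLyap hχg hχgs
    have hZ := integral_exp_neg_pos hVint
    have hmain := mul_le_mul_of_nonneg_left hmain (inv_pos.2 hZ).le
    rw [← integral_boltz hV.continuous hVint, ← integral_boltz hV.continuous hVint,
      ← hμ] at hmain
    have hfd : ∀ᵐ x ∂μ, ‖fderiv ℝ (fun x => χ x * g x) x‖ ^ 2 ≤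
        ‖fderiv ℝ g x‖ ^ 2 + (2 * L * M / r + M ^ 2 / r ^ 2) := by
      have hac := (boltz_absolutelyContinuous V).ae_le
      filter_upwards [hac hg.ae_differentiableAt, hac hχL.ae_differentiableAt] with x h1 h2
      rw [fderiv_fun_mul h2 h1]
      have h3 : ‖fderiv ℝ χ x‖ ≤ 1 / r := by
        have := norm_fderiv_le_of_lipschitz ℝ hχL (x₀ := x)
        rwa [Real.coe_toNNReal _ (by positivity)] at this
      have h4 : ‖χ x • fderiv ℝ g x + g x • fderiv ℝ χ x‖ ≤ ‖fderiv ℝ g x‖ + M * (1 / r) := by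
        refine (norm_add_le _ _).trans (add_le_add ?_ ?_)
        · rw [norm_smul, Real.norm_of_nonneg (hχ0 x)]
          exact (mul_le_mul_of_nonneg_right (hχ1 x) (norm_nonneg _)).trans_eq (one_mul _)
        · rw [norm_smul]
          exact mul_le_mul (hM x) h3 (norm_nonneg _) hM0
      have h5 := norm_fderiv_le_of_lipschitz ℝ hg (x₀ := x)
      refine (pow_le_pow_left₀ (norm_nonneg _) h4 2).trans ?_
      have h6 : 2 * ‖fderiv ℝ g x‖ * (M / r) ≤ 2 * L * (M / r) := by gcongr
      have e : (‖fderiv ℝ g x‖ + M * (1 / r)) ^ 2 =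
          ‖fderiv ℝ g x‖ ^ 2 + (2 * ‖fderiv ℝ g x‖ * (M / r) + M ^ 2 / r ^ 2) := by ring
      have e2 : 2 * L * M / r = 2 * L * (M / r) := by ring
      rw [e, e2]
      gcongr
    have hub : ∫ x, ‖fderiv ℝ (fun x => χ x * g x) x‖ ^ 2 ∂μ ≤
        E + (2 * L * M / r + M ^ 2 / r ^ 2) := by
      have := integral_mono_ae hχg.integrable_norm_fderiv_sq (iE.add (integrable_const _)) hfd
      simp only [Pi.add_apply] at this
      rw [integral_add iE (integrable_const _)] at this
      simpa using this
    have ic : Integrable (fun x => ‖x - x₀‖ ^ 2 * (χ x * g x) ^ 2) μ := by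
      refine Continuous.integrable_of_hasCompactSupport (by fun_prop) ?_
      exact (hχgs.comp_left (g := fun t : ℝ => t ^ 2) (by simp)).mul_left
    have iF' : Integrable (fun x => (χ x * g x) ^ 2) μ := by
      refine Continuous.integrable_of_hasCompactSupport (by fun_prop) ?_
      exact hχgs.comp_left (g := fun t : ℝ => t ^ 2) (by simp)
    have hFle : ∫ x, (χ x * g x) ^ 2 ∂μ ≤ F := by
      refine integral_mono iF' iF fun x => ?_
      simp only [mul_pow]
      have := pow_le_one₀ (hχ0 x) (hχ1 x) (n := 2)
      nlinarith [sq_nonneg (g x)]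
    have e : ∫ x, (c * ‖x - x₀‖ ^ 2 - b) * (χ x * g x) ^ 2 ∂μ =
        c * ∫ x, ‖x - x₀‖ ^ 2 * (χ x * g x) ^ 2 ∂μ - b * ∫ x, (χ x * g x) ^ 2 ∂μ := by
      rw [← integral_const_mul, ← integral_const_mul,
        ← integral_sub (ic.const_mul c) (iF'.const_mul b)]
      congr 1; ext x; ring
    rw [e] at hmain
    have hball : ∫ x in Metric.closedBall x₀ r, ‖x - x₀‖ ^ 2 * g x ^ 2 ∂μ ≤
        ∫ x, ‖x - x₀‖ ^ 2 * (χ x * g x) ^ 2 ∂μ := by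
      calc _ = ∫ x in Metric.closedBall x₀ r, ‖x - x₀‖ ^ 2 * (χ x * g x) ^ 2 ∂μ := by
            refine setIntegral_congr_fun measurableSet_closedBall fun x hx => ?_
            rw [mem_closedBall_iff_norm] at hx
            simp only [hχ, ballCutoff_eq_one x₀ hr hx, one_mul]
        _ ≤ _ := setIntegral_le_integral ic (ae_of_all _ fun x => by
            simp only [Pi.zero_apply]; positivity)
    have h1 := mul_le_mul_of_nonneg_left hball hc.le
    have h2 := mul_le_mul_of_nonneg_left hFle hb
    linarith
  have hcover : AECover μ atTop fun r : ℝ => Metric.closedBall x₀ r :=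
    aecover_closedBall tendsto_id
  have hInt : Integrable (fun x => ‖x - x₀‖ ^ 2 * g x ^ 2) μ := by
    refine hcover.integrable_of_integral_bounded_of_nonneg_ae
      ((E + (2 * L * M + M ^ 2) + b * F) / c) hon (ae_of_all _ fun x => by positivity) ?_
    filter_upwards [eventually_ge_atTop 1] with r hr
    rw [le_div_iff₀' hc]
    refine (key r (by linarith)).trans ?_
    have h1 : 2 * L * M / r ≤ 2 * L * M := div_le_self (by positivity) hr
    have h2 : M ^ 2 / r ^ 2 ≤ M ^ 2 := div_le_self (by positivity) (one_le_pow₀ hr)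
    gcongr
  refine ⟨hInt, ?_⟩
  have hlim : Tendsto (fun r : ℝ => E + (2 * L * M / r + M ^ 2 / r ^ 2) + b * F) atTop
      (𝓝 (E + (0 + 0) + b * F)) := by
    refine (tendsto_const_nhds.add (Tendsto.add ?_ ?_)).add tendsto_const_nhds
    · exact tendsto_const_nhds.div_atTop tendsto_id
    · exact tendsto_const_nhds.div_atTop (tendsto_pow_atTop two_ne_zero)
  have := le_of_tendsto_of_tendsto
    ((hcover.integral_tendsto_of_countably_generated hInt).const_mul c) hlim
    (by filter_upwards [eventually_gt_atTop 0] with r hr using key r hr)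
  linarith

end Lyapunov

section LocalPoincare

variable {n : ℕ}

theorem lintegral_lineMap_le_of_half_le {B : Set (En n)} (hB : MeasurableSet B) (hBc : Convex ℝ B)
    {ψ : En n → ℝ≥0∞} (hψ : Measurable ψ) {x : En n} (hx : x ∈ B) {t : ℝ} (ht : 1 / 2 ≤ t)
    (ht1 : t ≤ 1) :
    ∫⁻ y in B, ψ ((1 - t) • x + t • y) ≤ ENNReal.ofReal (2 ^ n) * ∫⁻ z in B, ψ z := by
  have ht0 : 0 < t := by linarith
  set F := B.indicator ψ with hF
  have hFm : Measurable F := hψ.indicator hB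
  calc ∫⁻ y in B, ψ ((1 - t) • x + t • y) = ∫⁻ y in B, F ((1 - t) • x + t • y) := by
        refine setLIntegral_congr_fun hB fun y hy => ?_
        rw [hF, indicator_of_mem (hBc hx hy (by linarith) ht0.le (by ring))]
    _ ≤ ∫⁻ y, F ((1 - t) • x + t • y) := setLIntegral_le_lintegral _ _
    _ = ∫⁻ z, F ((1 - t) • x + z) ∂(Measure.map (fun y => t • y) volume) := by
        rw [lintegral_map (by fun_prop) (by fun_prop)]
    _ = ENNReal.ofReal |(t ^ n)⁻¹| * ∫⁻ z in B, ψ z := by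
        rw [Measure.map_addHaar_smul _ ht0.ne', lintegral_smul_measure,
          lintegral_add_left_eq_self F, finrank_euclideanSpace_fin, lintegral_indicator hB,
          smul_eq_mul]
    _ ≤ _ := by
        gcongr
        rw [abs_of_pos (by positivity), ← inv_pow]
        refine pow_le_pow_left₀ (by positivity) ?_ n
        rw [inv_le_comm₀ ht0 two_pos]
        linarith

theorem lintegral_lintegral_lineMap_le {B : Set (En n)} (hB : MeasurableSet B)
    (hBc : Convex ℝ B) {ψ : En n → ℝ≥0∞} (hψ : Measurable ψ) {t : ℝ} (ht : t ∈ Icc (0 : ℝ) 1) :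
    ∫⁻ x in B, ∫⁻ y in B, ψ ((1 - t) • x + t • y) ≤
      ENNReal.ofReal (2 ^ n) * (∫⁻ z in B, ψ z) * volume B := by
  have key : ∀ s : ℝ, 1 / 2 ≤ s → s ≤ 1 → ∫⁻ x in B, ∫⁻ y in B, ψ ((1 - s) • x + s • y) ≤
      ENNReal.ofReal (2 ^ n) * (∫⁻ z in B, ψ z) * volume B := by
    intro s hs hs1
    calc _ ≤ ∫⁻ _ in B, ENNReal.ofReal (2 ^ n) * ∫⁻ z in B, ψ z :=
          setLIntegral_mono' hB fun x hx => lintegral_lineMap_le_of_half_le hB hBc hψ hx hs hs1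
      _ = _ := setLIntegral_const _ _
  rcases le_total (1 / 2) t with h | h
  · exact key t h ht.2
  · have h2 := key (1 - t) (by linarith) (by linarith [ht.1])
    rw [lintegral_lintegral_swap (by fun_prop)]
    simp only [sub_sub_cancel] at h2
    simpa only [add_comm] using h2

theorem LipschitzWith.sq_sub_le_lintegral {g : En n → ℝ} {L : NNReal} (hg : LipschitzWith L g)
    {x y : En n} (hd : ∀ᵐ t : ℝ, DifferentiableAt ℝ g ((1 - t) • x + t • y)) :
    ENNReal.ofReal ((g y - g x) ^ 2) ≤ ENNReal.ofReal (‖y - x‖ ^ 2) *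
      ∫⁻ t in Icc (0 : ℝ) 1, ENNReal.ofReal (‖fderiv ℝ g ((1 - t) • x + t • y)‖ ^ 2) := by
  set γ : ℝ → En n := fun t => (1 - t) • x + t • y with hγ
  have hγd : ∀ t, HasDerivAt γ (y - x) t := by
    intro t
    have := (((hasDerivAt_id t).const_sub 1).smul_const x).add ((hasDerivAt_id t).smul_const y)
    refine this.congr_deriv ?_
    simp only [neg_smul, one_smul]
    abel
  have hγL : LipschitzWith ‖y - x‖₊ γ := by
    refine LipschitzWith.of_dist_le_mul fun s t => ?_
    rw [dist_eq_norm, Real.dist_eq, coe_nnnorm]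
    have e : γ s - γ t = (s - t) • (y - x) := by
      simp only [hγ, sub_smul, smul_sub, one_smul]; abel
    rw [e, norm_smul, mul_comm, Real.norm_eq_abs]
  set f : ℝ → ℝ := g ∘ γ with hf
  have hfL : LipschitzWith (L * ‖y - x‖₊) f := hg.comp hγL
  have hftc := (hfL.lipschitzOnWith (s := uIcc 0 1)).absolutelyContinuousOnInterval
    |>.integral_deriv_eq_sub
  set D : ℝ → ℝ := fun t => ‖fderiv ℝ g (γ t)‖ with hD
  have hγm : Measurable γ := hγL.continuous.measurable
  have hDm : Measurable D := ((measurable_fderiv ℝ g).norm).comp hγm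
  have hderiv : ∀ᵐ t : ℝ, |deriv f t| ≤ D t * ‖y - x‖ := by
    filter_upwards [hd] with t ht
    rw [(ht.hasFDerivAt.comp_hasDerivAt t (hγd t)).deriv]
    exact (fderiv ℝ g (γ t)).le_opNorm _
  have hf01 : f 1 - f 0 = g y - g x := by simp [hf, hγ]
  set m := g y - g x with hm
  rw [hf01, intervalIntegral.integral_of_le zero_le_one, ← integral_Icc_eq_integral_Ioc] at hftc
  have : IsProbabilityMeasure ((volume : Measure ℝ).restrict (Icc 0 1)) := ⟨by simp⟩
  have iD : Integrable (fun t => D t ^ 2) ((volume : Measure ℝ).restrict (Icc 0 1)) := by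
    refine Integrable.of_bound (hDm.pow_const 2).aestronglyMeasurable ((L : ℝ) ^ 2)
      (ae_of_all _ fun t => ?_)
    rw [Real.norm_of_nonneg (by positivity)]
    exact pow_le_pow_left₀ (norm_nonneg _) (norm_fderiv_le_of_lipschitz ℝ hg) 2
  have if' : Integrable (deriv f) ((volume : Measure ℝ).restrict (Icc 0 1)) :=
    Integrable.of_bound (measurable_deriv f).aestronglyMeasurable _
      (ae_of_all _ fun t => norm_deriv_le_of_lipschitz hfL)
  have hle : m ^ 2 ≤ ‖y - x‖ ^ 2 * ∫ t in Icc (0 : ℝ) 1, D t ^ 2 := by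
    have h1 : ∫ t in Icc (0 : ℝ) 1, 2 * m * deriv f t ≤
        ∫ t in Icc (0 : ℝ) 1, (‖y - x‖ ^ 2 * D t ^ 2 + m ^ 2) := by
      refine integral_mono_ae (if'.const_mul _) ((iD.const_mul _).add (integrable_const _)) ?_
      filter_upwards [ae_restrict_of_ae hderiv] with t ht
      have h2 : (deriv f t) ^ 2 ≤ (D t * ‖y - x‖) ^ 2 := sq_le_sq.2 (ht.trans (le_abs_self _))
      nlinarith [sq_nonneg (deriv f t - m)]
    rw [integral_const_mul, hftc, integral_add (iD.const_mul _) (integrable_const _),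
      integral_const_mul] at h1
    simp only [integral_const, probReal_univ, one_smul] at h1
    linarith
  rw [← ofReal_integral_eq_lintegral_ofReal iD (ae_of_all _ fun t => by positivity),
    ← ENNReal.ofReal_mul (by positivity)]
  exact ENNReal.ofReal_le_ofReal hle

/-- Poincaré inequality on a ball, for Lebesgue measure. -/
theorem LipschitzWith.exists_lintegral_closedBall_sq_sub_le {g : En n → ℝ} {L : NNReal}
    (hg : LipschitzWith L g) (x₀ : En n) {R : ℝ} (hR : 0 < R) :
    ∃ a, ∫⁻ y in Metric.closedBall x₀ R, ENNReal.ofReal ((g y - g a) ^ 2) ≤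
      ENNReal.ofReal (4 * R ^ 2 * 2 ^ n) *
        ∫⁻ y in Metric.closedBall x₀ R, ENNReal.ofReal (‖fderiv ℝ g y‖ ^ 2) := by
  set B := Metric.closedBall x₀ R with hB
  have hBm : MeasurableSet B := measurableSet_closedBall
  have hBc : Convex ℝ B := convex_closedBall x₀ R
  have hB0 : volume B ≠ 0 := (Metric.measure_closedBall_pos volume x₀ hR).ne'
  have hBt : volume B ≠ ∞ := measure_closedBall_lt_top.ne
  set ψ : En n → ℝ≥0∞ := fun z => ENNReal.ofReal (‖fderiv ℝ g z‖ ^ 2) with hψ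
  have hψm : Measurable ψ := ((measurable_fderiv ℝ g).norm.pow_const 2).ennreal_ofReal
  have hgc := hg.continuous
  have hline : ∀ x ∈ B, ∫⁻ y in B, ENNReal.ofReal ((g y - g x) ^ 2) ≤
      ∫⁻ y in B, ENNReal.ofReal (4 * R ^ 2) *
        ∫⁻ t in Icc (0 : ℝ) 1, ψ ((1 - t) • x + t • y) := by
    intro x hx
    have hae : ∀ᵐ y : En n, ∀ᵐ t : ℝ, DifferentiableAt ℝ g ((1 - t) • x + t • y) := by
      have hmeas : MeasurableSet {p : En n × ℝ | DifferentiableAt ℝ g ((1 - p.2) • x + p.2 • p.1)} :=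
        (by fun_prop : Measurable fun p : En n × ℝ => (1 - p.2) • x + p.2 • p.1)
          (measurableSet_of_differentiableAt ℝ g)
      rw [Measure.ae_ae_comm hmeas]
      filter_upwards [compl_mem_ae_iff.2 (measure_singleton (0 : ℝ))] with t ht
      have ht : t ≠ 0 := ht
      have hqmp : Measure.QuasiMeasurePreserving (fun y : En n => (1 - t) • x + t • y) := by
        refine (measurePreserving_add_left volume ((1 - t) • x)).quasiMeasurePreserving.comp
          (g := fun z => (1 - t) • x + z) (f := fun y => t • y) ⟨by fun_prop, ?_⟩
        rw [Measure.map_addHaar_smul _ ht]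
        exact Measure.smul_absolutelyContinuous
      exact hqmp.ae hg.ae_differentiableAt
    refine setLIntegral_mono_ae' hBm ?_
    filter_upwards [hae] with y hy hyB
    refine (hg.sq_sub_le_lintegral hy).trans ?_
    gcongr
    have h1 : ‖y - x‖ ≤ 2 * R := by
      rw [mem_closedBall_iff_norm] at hx hyB
      have := _root_.norm_sub_le (y - x₀) (x - x₀)
      rw [sub_sub_sub_cancel_right] at this
      linarith
    calc ‖y - x‖ ^ 2 ≤ (2 * R) ^ 2 := by gcongr
      _ = 4 * R ^ 2 := by ring
  have hdouble : ∫⁻ x in B, ∫⁻ y in B, ENNReal.ofReal ((g y - g x) ^ 2) ≤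
      ENNReal.ofReal (4 * R ^ 2 * 2 ^ n) * (∫⁻ z in B, ψ z) * volume B := by
    calc _ ≤ ∫⁻ x in B, ∫⁻ y in B, ENNReal.ofReal (4 * R ^ 2) *
          ∫⁻ t in Icc (0 : ℝ) 1, ψ ((1 - t) • x + t • y) := setLIntegral_mono' hBm hline
      _ = ENNReal.ofReal (4 * R ^ 2) * ∫⁻ t in Icc (0 : ℝ) 1, ∫⁻ x in B, ∫⁻ y in B,
          ψ ((1 - t) • x + t • y) := by
        have h1 : ∀ x : En n, ∫⁻ y in B, ENNReal.ofReal (4 * R ^ 2) *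
            ∫⁻ t in Icc (0 : ℝ) 1, ψ ((1 - t) • x + t • y) = ENNReal.ofReal (4 * R ^ 2) *
            ∫⁻ t in Icc (0 : ℝ) 1, ∫⁻ y in B, ψ ((1 - t) • x + t • y) := by
          intro x
          rw [lintegral_const_mul' _ _ ENNReal.ofReal_ne_top,
            lintegral_lintegral_swap (by fun_prop)]
        simp only [h1]
        rw [lintegral_const_mul' _ _ ENNReal.ofReal_ne_top, lintegral_lintegral_swap]
        refine Measurable.aemeasurable ?_
        refine Measurable.lintegral_prod_right' (f := fun p : (En n × ℝ) × En n =>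
          ψ ((1 - p.1.2) • p.1.1 + p.1.2 • p.2)) ?_
        fun_prop
      _ ≤ ENNReal.ofReal (4 * R ^ 2) * ∫⁻ _ in Icc (0 : ℝ) 1,
          ENNReal.ofReal (2 ^ n) * (∫⁻ z in B, ψ z) * volume B := by
        exact mul_le_mul' le_rfl (setLIntegral_mono' measurableSet_Icc fun t ht =>
          lintegral_lintegral_lineMap_le hBm hBc hψm ht)
      _ = _ := by
        rw [setLIntegral_const, Real.volume_Icc,
          ENNReal.ofReal_mul (p := 4 * R ^ 2) (by positivity)]
        simp only [sub_zero, ENNReal.ofReal_one, mul_one]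
        ring
  obtain ⟨a, -, ha⟩ := exists_le_setLAverage (μ := volume) (s := B)
    (f := fun x => ∫⁻ y in B, ENNReal.ofReal ((g y - g x) ^ 2)) hB0 hBt (by
      refine Measurable.aemeasurable ?_
      refine Measurable.lintegral_prod_right' (f := fun p : En n × En n =>
        ENNReal.ofReal ((g p.2 - g p.1) ^ 2)) ?_
      fun_prop)
  refine ⟨a, ha.trans ?_⟩
  rw [setLAverage_eq]
  exact ENNReal.div_le_of_le_mul hdouble

end LocalPoincare

section Poincare

variable {n : ℕ} {V W : En n → ℝ} {x₀ : En n} {b c : ℝ}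

/-- Poincaré inequality on a ball for the Boltzmann measure. -/
theorem exists_setIntegral_boltz_sq_sub_le (hV : ContDiff ℝ 2 V)
    (hVint : Integrable (fun x => exp (-V x))) (x₀ : En n) {R : ℝ} (hR : 0 < R) :
    ∃ C, 0 ≤ C ∧ ∀ (g : En n → ℝ) (L : NNReal), LipschitzWith L g →
      ∃ a, ∫ x in Metric.closedBall x₀ R, (g x - g a) ^ 2 ∂(boltz V) ≤
        C * ∫ x, ‖fderiv ℝ g x‖ ^ 2 ∂(boltz V) := by
  have := isProbabilityMeasure_boltz hVint
  set B := Metric.closedBall x₀ R with hB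
  have hBm : MeasurableSet B := measurableSet_closedBall
  have hVc := hV.continuous
  obtain ⟨A, hA⟩ := (isCompact_closedBall x₀ R).exists_bound_of_continuousOn hVc.continuousOn
  have hZ := integral_exp_neg_pos hVint
  set Z := ∫ x, exp (-V x) with hZdef
  have hup : ∀ f : En n → ℝ≥0∞, Measurable f → ∫⁻ x in B, f x ∂(boltz V) ≤
      ENNReal.ofReal (exp A / Z) * ∫⁻ x in B, f x := by
    intro f hf
    rw [boltz, setLIntegral_withDensity_eq_setLIntegral_mul _ (by fun_prop) hf hBm,
      ← lintegral_const_mul' _ _ ENNReal.ofReal_ne_top]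
    refine setLIntegral_mono' hBm fun x hx => ?_
    simp only [Pi.mul_apply]
    have := (abs_le.1 (hA x hx)).1
    gcongr
    linarith
  have hlow : ∀ f : En n → ℝ≥0∞, Measurable f → ∫⁻ x in B, f x ≤
      ENNReal.ofReal (exp A * Z) * ∫⁻ x in B, f x ∂(boltz V) := by
    intro f hf
    rw [boltz, setLIntegral_withDensity_eq_setLIntegral_mul _ (by fun_prop) hf hBm,
      ← lintegral_const_mul' _ _ ENNReal.ofReal_ne_top]
    refine setLIntegral_mono' hBm fun x hx => ?_
    simp only [Pi.mul_apply]
    rw [← mul_assoc, ← ENNReal.ofReal_mul (by positivity)]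
    have h1 : 1 ≤ exp A * Z * (exp (-V x) / Z) := by
      have := (abs_le.1 (hA x hx)).2
      rw [mul_assoc, mul_div_cancel₀ _ hZ.ne', ← exp_add]
      exact one_le_exp (by linarith)
    calc f x = 1 * f x := (one_mul _).symm
      _ ≤ _ := by gcongr; exact ENNReal.one_le_ofReal.2 h1
  refine ⟨exp A / Z * (4 * R ^ 2 * 2 ^ n) * (exp A * Z), by positivity, fun g L hg => ?_⟩
  have hgc := hg.continuous
  have hfd := (measurable_fderiv ℝ g)
  obtain ⟨a, ha⟩ := hg.exists_lintegral_closedBall_sq_sub_le x₀ hR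
  refine ⟨a, ?_⟩
  have iE := hg.integrable_norm_fderiv_sq (μ := boltz V)
  have iB : IntegrableOn (fun x => (g x - g a) ^ 2) B (boltz V) :=
    (by fun_prop : Continuous fun x => (g x - g a) ^ 2).continuousOn.integrableOn_compact
      (isCompact_closedBall x₀ R)
  have key : ENNReal.ofReal (∫ x in B, (g x - g a) ^ 2 ∂(boltz V)) ≤ ENNReal.ofReal
      (exp A / Z * (4 * R ^ 2 * 2 ^ n) * (exp A * Z) * ∫ x in B, ‖fderiv ℝ g x‖ ^ 2 ∂(boltz V)) := by
    rw [ENNReal.ofReal_mul (by positivity), ENNReal.ofReal_mul (by positivity),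
      ENNReal.ofReal_mul (by positivity),
      ofReal_integral_eq_lintegral_ofReal iB (ae_of_all _ fun x => by positivity),
      ofReal_integral_eq_lintegral_ofReal iE.integrableOn (ae_of_all _ fun x => by positivity)]
    refine (hup _ (by fun_prop)).trans ?_
    rw [mul_assoc, mul_assoc]
    gcongr
    refine ha.trans ?_
    gcongr
    exact hlow _ (by fun_prop)
  rw [ENNReal.ofReal_le_ofReal_iff (mul_nonneg (by positivity)
    (integral_nonneg fun x => by positivity))] at key
  exact key.trans (mul_le_mul_of_nonneg_left (setIntegral_le_integral iE
    (ae_of_all _ fun x => by simp only [Pi.zero_apply]; positivity)) (by positivity))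

/-- Poincaré inequality under the Lyapunov condition. -/
theorem exists_poincare_of_lyapunov (hV : ContDiff ℝ 2 V) (hW : ContDiff ℝ 2 W)
    (hW1 : ∀ x, 1 ≤ W x) (hVint : Integrable (fun x => exp (-V x))) (hb : 0 < b) (hc : 0 < c)
    (hLyap : ∀ x, Lop V W x ≤ (-c * ‖x - x₀‖ ^ 2 + b) * W x) :
    ∃ C, 0 ≤ C ∧ ∀ (g : En n → ℝ) (L : NNReal) (M : ℝ), LipschitzWith L g → (∀ x, |g x| ≤ M) →
      ∫ x, g x ^ 2 ∂(boltz V) - (∫ x, g x ∂(boltz V)) ^ 2 ≤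
        C * ∫ x, ‖fderiv ℝ g x‖ ^ 2 ∂(boltz V) := by
  have := isProbabilityMeasure_boltz hVint
  set μ := boltz V with hμ
  set R := √((b + 1) / c) with hR
  have hR0 : 0 < R := by positivity
  obtain ⟨C, hC0, hC⟩ := exists_setIntegral_boltz_sq_sub_le hV hVint x₀ hR0
  refine ⟨1 + (b + 1) * C, by positivity, fun g L M hg hM => ?_⟩
  obtain ⟨a, ha⟩ := hC g L hg
  set B := Metric.closedBall x₀ R with hB
  have hBm : MeasurableSet B := measurableSet_closedBall
  have hgc := hg.continuous
  have hg' : LipschitzWith L fun x => g x - g a := by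
    refine LipschitzWith.of_dist_le_mul fun x y => ?_
    have := hg.dist_le_mul x y
    rw [Real.dist_eq] at this ⊢
    rwa [sub_sub_sub_cancel_right]
  have hM' : ∀ x, |g x - g a| ≤ M + M := fun x =>
    (abs_sub _ _).trans (add_le_add (hM x) (hM a))
  obtain ⟨iD, hD⟩ := lyapunov_integral_le hV hW hW1 hVint hc hb.le hLyap hg' hM'
  rw [← hμ] at iD hD
  simp only [fderiv_sub_const] at hD
  set E := ∫ x, ‖fderiv ℝ g x‖ ^ 2 ∂μ
  have ig : Integrable g μ := hgc.integrable_of_abs_le hM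
  have ig2 : Integrable (fun x => g x ^ 2) μ :=
    Continuous.integrable_of_abs_le (by fun_prop) (M := M ^ 2) fun x => by
      rw [abs_pow]; exact pow_le_pow_left₀ (abs_nonneg _) (hM x) 2
  have is : Integrable (fun x => (g x - g a) ^ 2) μ :=
    Continuous.integrable_of_abs_le (by fun_prop) (M := (M + M) ^ 2) fun x => by
      rw [abs_pow]; exact pow_le_pow_left₀ (abs_nonneg _) (hM' x) 2
  have hvar : ∫ x, g x ^ 2 ∂μ - (∫ x, g x ∂μ) ^ 2 ≤ ∫ x, (g x - g a) ^ 2 ∂μ := by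
    have e : ∀ x, (g x - g a) ^ 2 = g x ^ 2 - 2 * g a * g x + g a ^ 2 := by intro x; ring
    simp only [e]
    have i1 : Integrable (fun x => g x ^ 2 - 2 * g a * g x) μ := ig2.sub (ig.const_mul _)
    rw [integral_add i1 (integrable_const _), integral_sub ig2 (ig.const_mul _),
      integral_const_mul]
    simp only [integral_const, probReal_univ, one_smul]
    nlinarith [sq_nonneg (∫ x, g x ∂μ - g a)]
  have hpt : ∀ x, (g x - g a) ^ 2 ≤ c * (‖x - x₀‖ ^ 2 * (g x - g a) ^ 2) -
      b * (g x - g a) ^ 2 + (b + 1) * B.indicator (fun x => (g x - g a) ^ 2) x := by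
    intro x
    by_cases hx : x ∈ B
    · rw [indicator_of_mem hx]
      have : 0 ≤ c * (‖x - x₀‖ ^ 2 * (g x - g a) ^ 2) := by positivity
      linarith
    · rw [indicator_of_notMem hx]
      rw [hB, mem_closedBall_iff_norm, not_le] at hx
      have h1 : R ^ 2 ≤ ‖x - x₀‖ ^ 2 := by gcongr
      rw [hR, Real.sq_sqrt (by positivity), div_le_iff₀' hc] at h1
      have := mul_le_mul_of_nonneg_right h1 (sq_nonneg (g x - g a))
      linarith
  have i1 : Integrable (fun x => c * (‖x - x₀‖ ^ 2 * (g x - g a) ^ 2) - b * (g x - g a) ^ 2) μ :=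
    (iD.const_mul c).sub (is.const_mul b)
  have i2 : Integrable (fun x => (b + 1) * B.indicator (fun x => (g x - g a) ^ 2) x) μ :=
    (is.indicator hBm).const_mul _
  have hsum := integral_mono is (i1.add i2) hpt
  simp only [Pi.add_apply] at hsum
  rw [integral_add i1 i2, integral_sub (iD.const_mul c) (is.const_mul b), integral_const_mul,
    integral_const_mul, integral_const_mul, integral_indicator hBm] at hsum
  have h2 := mul_le_mul_of_nonneg_left ha (by positivity : 0 ≤ b + 1)
  linarith

end Poincare

section Assembly

theorem hopfLax_sub_const {n : ℕ} {h : En n → ℝ} {M t : ℝ} (hM : ∀ x, |h x| ≤ M) (ht : 0 < t)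
    (a : ℝ) (x : En n) : hopfLax (fun y => h y - a) t x = hopfLax h t x - a := by
  refine le_antisymm ?_ (le_hopfLax fun y => ?_)
  · refine le_sub_iff_add_le.2 (le_hopfLax fun y => ?_)
    have hM' : ∀ x, |h x - a| ≤ M + |a| := fun x => (abs_sub _ _).trans (by gcongr; exact hM x)
    have := hopfLax_le hM' ht x y
    linarith
  · have := hopfLax_le hM ht x y
    linarith

/-- Entropy inequality (Donsker–Varadhan). -/
theorem integral_mul_le_integral_mul_log {α : Type*} [MeasurableSpace α] {μ : Measure α}
    [IsFiniteMeasure μ] {f φ : α → ℝ} {M : ℝ} (hf0 : ∀ x, 0 ≤ f x) (hf1 : ∫ x, f x ∂μ = 1)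
    (hfl : Integrable (fun x => f x * log (f x)) μ) (hφ : Measurable φ) (hM : ∀ x, |φ x| ≤ M)
    (hexp : ∫ x, exp (φ x) ∂μ ≤ 1) :
    ∫ x, f x * φ x ∂μ ≤ ∫ x, f x * log (f x) ∂μ := by
  have hf : Integrable f μ := by
    by_contra hcon
    rw [integral_undef hcon] at hf1
    exact zero_ne_one hf1
  have i1 : Integrable (fun x => f x * φ x) μ :=
    hf.mul_bdd (c := M) hφ.aestronglyMeasurable (ae_of_all _ hM)
  have i2 : Integrable (fun x => exp (φ x)) μ :=
    Integrable.of_bound (by fun_prop) (exp M) (ae_of_all _ fun x => by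
      rw [norm_eq_abs, abs_exp]
      exact exp_le_exp.2 ((le_abs_self _).trans (hM x)))
  have i3 : Integrable (fun x => f x * log (f x) - f x) μ := hfl.sub hf
  have key : ∫ x, f x * φ x ∂μ ≤ ∫ x, (f x * log (f x) - f x + exp (φ x)) ∂μ := by
    refine integral_mono i1 (i3.add i2) fun x => ?_
    rcases (hf0 x).eq_or_lt with h0 | h0
    · simp only [← h0]
      have := exp_pos (φ x)
      linarith
    · have h1 := mul_le_mul_of_nonneg_left (add_one_le_exp (φ x - log (f x))) h0.le
      rw [exp_sub, exp_log h0, mul_div_cancel₀ _ h0.ne'] at h1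
      linarith
  rw [integral_add i3 i2, integral_sub hfl hf, hf1] at key
  linarith

variable {n : ℕ} {V W : En n → ℝ} {x₀ : En n} {b c : ℝ}

theorem integrable_norm_sub_sq_of_lyapunov (hV : ContDiff ℝ 2 V) (hW : ContDiff ℝ 2 W)
    (hW1 : ∀ x, 1 ≤ W x) (hVint : Integrable (fun x => exp (-V x))) (hb : 0 ≤ b) (hc : 0 < c)
    (hLyap : ∀ x, Lop V W x ≤ (-c * ‖x - x₀‖ ^ 2 + b) * W x) :
    Integrable (fun x => ‖x - x₀‖ ^ 2) (boltz V) := by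
  simpa using (lyapunov_integral_le hV hW hW1 hVint hc hb hLyap (LipschitzWith.const (1 : ℝ))
    (M := 1) (fun x => by simp)).1

/-- Infimum-convolution inequality under the Lyapunov condition. -/
theorem exists_integral_exp_hopfLax_sub_le_one (hV : ContDiff ℝ 2 V) (hW : ContDiff ℝ 2 W)
    (hW1 : ∀ x, 1 ≤ W x) (hVint : Integrable (fun x => exp (-V x))) (hb : 0 < b) (hc : 0 < c)
    (hLyap : ∀ x, Lop V W x ≤ (-c * ‖x - x₀‖ ^ 2 + b) * W x) :
    ∃ l, 0 < l ∧ ∀ (h : En n → ℝ) (M : ℝ), Measurable h → (∀ x, |h x| ≤ M) →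
      ∫ x, exp (l * (hopfLax h 1 x - ∫ y, h y ∂(boltz V))) ∂(boltz V) ≤ 1 := by
  have := isProbabilityMeasure_boltz hVint
  have hD := integrable_norm_sub_sq_of_lyapunov hV hW hW1 hVint hb.le hc hLyap
  obtain ⟨C, hC, hP⟩ := exists_poincare_of_lyapunov hV hW hW1 hVint hb hc hLyap
  set m := ∫ y, ‖y - x₀‖ ^ 2 ∂(boltz V) with hm
  have hm0 : 0 ≤ m := integral_nonneg fun y => by positivity
  set T := ((9 + 4 * 1 * (m + b / c)) * (2 * C) + 4 * 1 / c) / 4 with hT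
  have hT0 : 0 ≤ T := by positivity
  set l := 1 / (2 * T + 1) with hl
  have hl0 : 0 < l := by positivity
  have hl1 : l ≤ 1 := by
    rw [hl, div_le_one (by positivity)]
    linarith
  have hlT : 2 * l * T ≤ 1 := by
    rw [hl, mul_one_div, div_mul_eq_mul_div, div_le_one (by positivity)]
    linarith
  refine ⟨l, hl0, fun h M hh hM => ?_⟩
  have hi : Integrable h (boltz V) :=
    Integrable.of_bound hh.aestronglyMeasurable M (ae_of_all _ hM)
  set a := ∫ y, h y ∂(boltz V) with ha
  simp only [← hopfLax_sub_const hM one_pos]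
  refine integral_exp_hopfLax_le_one (boltz_absolutelyContinuous V) x₀ hl0 hD ?_
    (h := fun y => h y - a) (hh.sub_const a) (M := M + |a|)
    (fun x => (abs_sub _ _).trans (by gcongr; exact hM x))
    (by rw [integral_sub hi (integrable_const _), ← ha]; simp)
  intro u L N hu hN hquad hone
  have hE := entropy_exp_le_of_poincare (boltz_absolutelyContinuous V) x₀ hb.le hc hm0 hl0.le
    (fun g L M hg hM => lyapunov_integral_le hV hW hW1 hVint hc hb.le hLyap hg hM) hP
    hu hN hquad hone
  set I := ∫ x, ‖fderiv ℝ u x‖ ^ 2 * exp (u x) ∂(boltz V) with hI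
  have hI0 : 0 ≤ I := integral_nonneg fun x => by positivity
  have hTl : ((9 + 4 * l * (m + b / c)) * (2 * C) + 4 * l / c) / 4 ≤ T := by
    rw [hT]
    gcongr
  calc _ ≤ 2 * l * (T * I) := by
        gcongr
        exact hE.trans (by gcongr)
    _ = 2 * l * T * I := by ring
    _ ≤ 1 * I := by gcongr
    _ = I := one_mul I

end Assembly

/-- the Lyapunov condition `LW ≤ (-c d²(x,x₀) + b) W` implies the Talagrand
transportation inequality `W₂(f dμ, μ) ≤ √(K Ent_μ(f))`. -/
theorem stmt10 {n : ℕ} (hn : 0 < n) (V : En n → ℝ) (hV : ContDiff ℝ 2 V)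
    (hVint : Integrable (fun x => Real.exp (-V x)))
    (W : En n → ℝ) (hW : ContDiff ℝ 2 W) (hW1 : ∀ x, 1 ≤ W x)
    (x₀ : En n) (b c : ℝ) (hb : 0 < b) (hc : 0 < c)
    (hLyap : ∀ x, Lop V W x ≤ (-c * ‖x - x₀‖ ^ 2 + b) * W x) :
    ∃ K : ℝ, 0 < K ∧
      ∀ f : En n → ℝ, Measurable f → (∀ x, 0 ≤ f x) →
        (∫ x, f x ∂(boltz V)) = 1 →
        Integrable (fun x => f x * Real.log (f x)) (boltz V) →
        Wp 2 ((boltz V).withDensity (fun x => ENNReal.ofReal (f x))) (boltz V)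
          ≤ ENNReal.ofReal (Real.sqrt (K * ∫ x, f x * Real.log (f x) ∂(boltz V))) := by
  have := isProbabilityMeasure_boltz hVint
  have hD := integrable_norm_sub_sq_of_lyapunov hV hW hW1 hVint hb.le hc hLyap
  obtain ⟨l, hl, hexp⟩ :=
    exists_integral_exp_hopfLax_sub_le_one hV hW hW1 hVint hb hc hLyap
  refine ⟨4 / l, by positivity, fun f hfm hf0 hf1 hfl => ?_⟩
  set μ := boltz V with hμ
  set ν := μ.withDensity fun x => ENNReal.ofReal (f x) with hν
  set S := ∫ x, f x * log (f x) ∂μ with hS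
  have hfi : Integrable f μ := by
    by_contra hcon
    rw [integral_undef hcon] at hf1
    exact zero_ne_one hf1
  have hνp : IsProbabilityMeasure ν := ⟨by
    rw [hν, withDensity_apply _ MeasurableSet.univ, Measure.restrict_univ,
      ← ofReal_integral_eq_lintegral_ofReal hfi (ae_of_all _ hf0), hf1, ENNReal.ofReal_one]⟩
  have hS0 : 0 ≤ S := by
    simpa using integral_mul_le_integral_mul_log hf0 hf1 hfl (φ := fun _ => 0) measurable_const
      (M := 0) (by simp) (by simp)
  have hνint : ∀ φ : En n → ℝ, ∫ x, φ x ∂ν = ∫ x, f x * φ x ∂μ := fun φ => by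
    rw [hν, integral_withDensity_eq_integral_toReal_smul (by fun_prop) (by simp)]
    simp [hf0]
  have H : ∀ h : En n → ℝ, Measurable h → (∃ M, ∀ x, |h x| ≤ M) →
      ∫ x, hopfLax h 1 x ∂ν ≤ ∫ x, h x ∂μ + S / l := by
    rintro h hh ⟨M, hM⟩
    obtain ⟨L, hL⟩ := exists_lipschitzWith_hopfLax hM one_pos
    have hQ : Integrable (hopfLax h 1) ν :=
      hL.continuous.integrable_of_abs_le (abs_hopfLax_le hM one_pos)
    set a := ∫ x, h x ∂μ with ha
    have hbd : ∀ x, |l * (hopfLax h 1 x - a)| ≤ l * (M + |a|) := fun x => by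
      rw [abs_mul, abs_of_pos hl]
      gcongr
      exact (abs_sub _ _).trans (by gcongr; exact abs_hopfLax_le hM one_pos x)
    have hLm := hL.continuous.measurable
    have key := integral_mul_le_integral_mul_log hf0 hf1 hfl
      (φ := fun x => l * (hopfLax h 1 x - a)) (by fun_prop) hbd (hexp h M hh hM)
    rw [← hνint, integral_const_mul, integral_sub hQ (integrable_const _)] at key
    rw [← sub_le_iff_le_add', le_div_iff₀' hl]
    simpa using key
  have hμ2 : ∫⁻ x, ENNReal.ofReal (‖x - x₀‖ ^ 2) ∂μ ≠ ∞ := by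
    rw [← ofReal_integral_eq_lintegral_ofReal hD (ae_of_all _ fun x => by positivity)]
    exact ENNReal.ofReal_ne_top
  have hν2 : ∫⁻ x, ENNReal.ofReal (‖x - x₀‖ ^ 2) ∂ν ≠ ∞ := by
    set m := ∫ y, ‖y - x₀‖ ^ 2 ∂μ with hm
    have hbound : ∀ k : ℕ, ∫⁻ x, ENNReal.ofReal (min (‖x - x₀‖ ^ 2) k) ∂ν ≤
        ENNReal.ofReal (4 * (m / 2 + S / l)) := by
      intro k
      have hcont : Continuous fun x : En n => min (‖x - x₀‖ ^ 2) (k : ℝ) := by fun_prop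
      have h0 : ∀ x : En n, 0 ≤ min (‖x - x₀‖ ^ 2) (k : ℝ) := fun x => by positivity
      have hk : ∀ x : En n, |min (‖x - x₀‖ ^ 2) (k : ℝ)| ≤ k := fun x => by
        rw [abs_of_nonneg (h0 x)]
        exact min_le_right _ _
      have hk2 : ∀ x : En n, |min (‖x - x₀‖ ^ 2) (k : ℝ) / 2| ≤ k := fun x => by
        have := hk x
        rw [abs_div, abs_two]
        have := abs_nonneg (min (‖x - x₀‖ ^ 2) (k : ℝ))
        linarith
      have iν := hcont.integrable_of_abs_le (μ := ν) hk
      rw [← ofReal_integral_eq_lintegral_ofReal iν (ae_of_all _ h0)]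
      refine ENNReal.ofReal_le_ofReal ?_
      obtain ⟨L, hL⟩ := exists_lipschitzWith_hopfLax hk2 one_pos
      have h1 := H _ (by fun_prop) ⟨k, hk2⟩
      have h2 : ∫ x, min (‖x - x₀‖ ^ 2) (k : ℝ) / 4 ∂ν ≤
          ∫ x, hopfLax (fun y => min (‖y - x₀‖ ^ 2) (k : ℝ) / 2) 1 x ∂ν := by
        refine integral_mono (iν.div_const 4)
          (hL.continuous.integrable_of_abs_le (abs_hopfLax_le hk2 one_pos)) fun x =>
          le_hopfLax fun y => ?_
        have htri : ‖x - x₀‖ ≤ ‖x - y‖ + ‖y - x₀‖ := norm_sub_le_norm_sub_add_norm_sub _ _ _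
        have hsq : ‖x - x₀‖ ^ 2 ≤ 2 * ‖x - y‖ ^ 2 + 2 * ‖y - x₀‖ ^ 2 := by
          nlinarith [norm_nonneg (x - x₀), sq_nonneg (‖x - y‖ - ‖y - x₀‖)]
        have hxy := sq_nonneg ‖x - y‖
        rcases min_cases (‖y - x₀‖ ^ 2) (k : ℝ) with ⟨e, -⟩ | ⟨e, -⟩
        · rw [e]
          have := min_le_left (‖x - x₀‖ ^ 2) (k : ℝ)
          linarith
        · rw [e]
          have := min_le_right (‖x - x₀‖ ^ 2) (k : ℝ)
          have : (0 : ℝ) ≤ k := k.cast_nonneg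
          linarith
      have h3 : ∫ x, min (‖x - x₀‖ ^ 2) (k : ℝ) / 2 ∂μ ≤ m / 2 := by
        rw [integral_div]
        exact div_le_div_of_nonneg_right
          (integral_mono (hcont.integrable_of_abs_le hk) hD fun x => min_le_left _ _) two_pos.le
      rw [integral_div] at h2
      linarith
    have hsup : ∀ x : En n, ENNReal.ofReal (‖x - x₀‖ ^ 2) =
        ⨆ k : ℕ, ENNReal.ofReal (min (‖x - x₀‖ ^ 2) k) := fun x => by
      refine le_antisymm ?_ (iSup_le fun k => ENNReal.ofReal_le_ofReal (min_le_left _ _))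
      obtain ⟨k, hk⟩ := exists_nat_ge (‖x - x₀‖ ^ 2)
      exact le_iSup_of_le k (by rw [min_eq_left hk])
    simp only [hsup]
    rw [lintegral_iSup (fun k => by fun_prop) fun k k' hkk' x => by
      dsimp only
      gcongr]
    exact ((iSup_le hbound).trans_lt ENNReal.ofReal_lt_top).ne
  refine (Wp_two_le_of_hopfLax_le x₀ ν μ hν2 hμ2 (by positivity) H).trans_eq ?_
  rw [mul_div_assoc', div_mul_eq_mul_div]
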